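/- arXiv:1211.1797 — 8 statements merged into one kernel-verified Lean document; each statement's English description precedes it below -/
import Mathlib

section
/- Let m and n be positive integers. For every (a,b,t) ∈ I_{m,n}, the set H_{a,b,t} is a subgroup of ℤ_m × ℤ_n of order (m·n)/(a·b), and the map (a,b,t) ↦ H_{a,b,t} is a bijection between the set I_{m,n} and the set of all subgroups of ℤ_m × ℤ_n. -/
/-- The index set `I_{m,n}` of triples `(a,b,t)` with `a ∣ m`, `b ∣ n` and
`0 ≤ t ≤ gcd(a, n/b) - 1`. -/
def Imn (m n : ℕ) : Set (ℕ × ℕ × ℕ) :=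
  {p | 0 < p.1 ∧ 0 < p.2.1 ∧ p.1 ∣ m ∧ p.2.1 ∣ n ∧ p.2.2 ≤ Nat.gcd p.1 (n / p.2.1) - 1}

/-- The subset `H_{a,b,t}` of `ℤ_m × ℤ_n`, given by the elements
`(i·a + j·s mod m, j·b mod n)` with `0 ≤ i ≤ m/a - 1`, `0 ≤ j ≤ n/b - 1`,
where `s = t·a / gcd(a, n/b)`. -/
def Habt (m n a b t : ℕ) : Set (ZMod m × ZMod n) :=
  {x | ∃ i j : ℕ, i ≤ m / a - 1 ∧ j ≤ n / b - 1 ∧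
    x = (((i * a + j * (t * a / Nat.gcd a (n / b)) : ℕ) : ZMod m),
         ((j * b : ℕ) : ZMod n))}

theorem exists_nat_generator_of_int (K : AddSubgroup ℤ) :
    ∃ d : ℕ, ∀ x : ℤ, x ∈ K ↔ (d : ℤ) ∣ x := by
  obtain ⟨d, hd⟩ := Int.subgroup_cyclic K
  refine ⟨d.natAbs, fun x => ?_⟩
  rw [hd, Int.natAbs_dvd, AddSubgroup.mem_closure_singleton]
  constructor
  · rintro ⟨k, rfl⟩
    exact ⟨k, by simp [mul_comm]⟩
  · rintro ⟨k, rfl⟩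
    exact ⟨k, by simp [mul_comm]⟩

theorem exists_intCast_prod {m n : ℕ} (z : ZMod m × ZMod n) :
    ∃ x y : ℤ, z = ((x : ZMod m), (y : ZMod n)) := by
  obtain ⟨x, hx⟩ := ZMod.intCast_surjective z.1
  obtain ⟨y, hy⟩ := ZMod.intCast_surjective z.2
  exact ⟨x, y, by rw [hx, hy]⟩

theorem exists_nat_mod_eq (v : ℤ) {N : ℕ} (hN : 0 < N) :
    ∃ j : ℕ, j ≤ N - 1 ∧ ∃ q : ℤ, v = j + N * q := by
  have hN' : (0 : ℤ) < N := by exact_mod_cast hN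
  obtain ⟨j, hj⟩ := Int.eq_ofNat_of_zero_le (Int.emod_nonneg v hN'.ne')
  have hlt := Int.emod_lt_of_pos v hN'
  refine ⟨j, by omega, v / N, ?_⟩
  have := Int.emod_add_mul_ediv v N
  omega

theorem dvd_mul_shift {a : ℕ} (N t : ℕ) (ha : 0 < a) :
    a ∣ N * (t * a / Nat.gcd a N) := by
  obtain ⟨c, hc⟩ := Nat.gcd_dvd_right a N
  obtain ⟨d, hd⟩ := Nat.gcd_dvd_left a N
  have hda : t * a / Nat.gcd a N = t * d := by
    apply Nat.div_eq_of_eq_mul_right (Nat.gcd_pos_of_pos_left _ ha)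
    rw [mul_left_comm, ← hd]
  refine ⟨c * t, ?_⟩
  rw [hda]
  calc N * (t * d) = (Nat.gcd a N * c) * (t * d) := by rw [← hc]
    _ = (Nat.gcd a N * d) * (c * t) := by ring
    _ = a * (c * t) := by rw [← hd]

theorem shift_lt {a N t : ℕ} (ha : 0 < a) (ht : t ≤ Nat.gcd a N - 1) :
    t * a / Nat.gcd a N < a := by
  have hg := Nat.gcd_pos_of_pos_left N ha
  rw [Nat.div_lt_iff_lt_mul hg, mul_comm a]
  exact Nat.mul_lt_mul_of_pos_right (by omega) ha

theorem shift_injective {a N t t' : ℕ} (ha : 0 < a)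
    (h : t * a / Nat.gcd a N = t' * a / Nat.gcd a N) : t = t' := by
  have hg := Nat.gcd_dvd_left a N
  rw [Nat.mul_div_assoc _ hg, Nat.mul_div_assoc _ hg] at h
  exact Nat.eq_of_mul_eq_mul_right
    (Nat.div_pos (Nat.le_of_dvd ha hg) (Nat.gcd_pos_of_pos_left _ ha)) h

theorem exists_shift_eq {a N s : ℕ} (ha : 0 < a) (hs : s < a) (h : a ∣ N * s) :
    ∃ t ≤ Nat.gcd a N - 1, t * a / Nat.gcd a N = s := by
  have hg := Nat.gcd_pos_of_pos_left N ha
  obtain ⟨d, hd⟩ := Nat.gcd_dvd_left a N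
  have hds : d ∣ s := by
    have h1 : a ∣ Nat.gcd a N * s := by
      rw [← Nat.gcd_mul_right]
      exact Nat.dvd_gcd (dvd_mul_right _ _) h
    refine Nat.dvd_of_mul_dvd_mul_left hg ?_
    rwa [← hd]
  obtain ⟨t, rfl⟩ := hds
  refine ⟨t, ?_, ?_⟩
  · have : d * t < d * Nat.gcd a N := by rwa [mul_comm d (Nat.gcd a N), ← hd]
    have := Nat.lt_of_mul_lt_mul_left this
    omega
  · apply Nat.div_eq_of_eq_mul_right hg
    rw [← mul_assoc, ← hd, mul_comm]

/-- An integer pair reduces into `H_{a,b,t}` exactly when it lies in the lattice spanned by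
`(a, 0)` and `(s, b)`. -/
theorem intCast_mem_Habt_iff {m n a b : ℕ} (t : ℕ) (hm : 0 < m) (hn : 0 < n) (ham : a ∣ m)
    (hbn : b ∣ n) (x y : ℤ) :
    ((x : ZMod m), (y : ZMod n)) ∈ Habt m n a b t ↔
      ∃ v : ℤ, y = v * b ∧ (a : ℤ) ∣ x - v * (t * a / Nat.gcd a (n / b) : ℕ) := by
  have ha := Nat.pos_of_dvd_of_pos ham hm
  have hb := Nat.pos_of_dvd_of_pos hbn hn
  have hs := dvd_mul_shift (n / b) t ha
  unfold Habt
  generalize t * a / Nat.gcd a (n / b) = s at hs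
  obtain ⟨M, rfl⟩ := ham
  obtain ⟨N, rfl⟩ := hbn
  rw [Nat.mul_div_cancel_left _ hb] at hs
  rw [Set.mem_ofPred_eq, Nat.mul_div_cancel_left _ hb, Nat.mul_div_cancel_left _ ha]
  obtain ⟨c, hc⟩ := hs
  have hc' : (N : ℤ) * s = a * c := by exact_mod_cast hc
  constructor
  · rintro ⟨i, j, -, -, h⟩
    obtain ⟨h1, h2⟩ := Prod.ext_iff.1 h
    dsimp only at h1 h2
    rw [← Int.cast_natCast (j * b)] at h2
    rw [← Int.cast_natCast (i * a + j * s)] at h1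
    rw [ZMod.intCast_eq_intCast_iff_dvd_sub] at h1 h2
    obtain ⟨p, hp⟩ := h1
    obtain ⟨q, hq⟩ := h2
    push_cast at hp hq
    refine ⟨j - N * q, by linear_combination -hq, i - M * p + q * c, ?_⟩
    linear_combination -hp + q * hc'
  · rintro ⟨v, rfl, u, hu⟩
    obtain ⟨j, hj, q, hq⟩ := exists_nat_mod_eq v (Nat.pos_of_mul_pos_left hn)
    obtain ⟨i, hi, p, hp⟩ := exists_nat_mod_eq (u + q * c) (Nat.pos_of_mul_pos_left hm)
    refine ⟨i, j, hi, hj, Prod.ext ?_ ?_⟩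
    · dsimp only
      rw [← Int.cast_natCast (i * a + j * s), ZMod.intCast_eq_intCast_iff_dvd_sub]
      refine ⟨-p, ?_⟩
      push_cast
      linear_combination -hu - a * hp - s * hq - q * hc'
    · dsimp only
      rw [← Int.cast_natCast (j * b), ZMod.intCast_eq_intCast_iff_dvd_sub]
      refine ⟨-q, ?_⟩
      push_cast
      linear_combination -b * hq

theorem exists_addSubgroup_coe_eq_Habt {m n a b : ℕ} (t : ℕ) (hm : 0 < m) (hn : 0 < n)
    (ham : a ∣ m) (hbn : b ∣ n) :
    ∃ H : AddSubgroup (ZMod m × ZMod n), (H : Set (ZMod m × ZMod n)) = Habt m n a b t := by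
  have key := intCast_mem_Habt_iff t hm hn ham hbn
  refine ⟨{ carrier := Habt m n a b t, zero_mem' := ?_, add_mem' := ?_, neg_mem' := ?_ }, rfl⟩
  · intro z w hz hw
    obtain ⟨x, y, rfl⟩ := exists_intCast_prod z
    obtain ⟨x', y', rfl⟩ := exists_intCast_prod w
    obtain ⟨v, rfl, hv⟩ := (key _ _).1 hz
    obtain ⟨v', rfl, hv'⟩ := (key _ _).1 hw
    rw [Prod.mk_add_mk, ← Int.cast_add, ← Int.cast_add, key]
    obtain ⟨c, hc⟩ := hv
    obtain ⟨c', hc'⟩ := hv'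
    exact ⟨v + v', by ring, c + c', by linear_combination hc + hc'⟩
  · have := (key 0 0).2 ⟨0, by simp, by simp⟩
    rwa [Int.cast_zero, Int.cast_zero] at this
  · intro z hz
    obtain ⟨x, y, rfl⟩ := exists_intCast_prod z
    obtain ⟨v, rfl, hv⟩ := (key _ _).1 hz
    rw [Prod.neg_mk, ← Int.cast_neg, ← Int.cast_neg, key]
    obtain ⟨c, hc⟩ := hv
    exact ⟨-v, by ring, -c, by linear_combination -hc⟩

theorem ncard_Habt {m n a b : ℕ} (t : ℕ) (hm : 0 < m) (hn : 0 < n) (ham : a ∣ m)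
    (hbn : b ∣ n) : (Habt m n a b t).ncard = m * n / (a * b) := by
  have ha := Nat.pos_of_dvd_of_pos ham hm
  have hb := Nat.pos_of_dvd_of_pos hbn hn
  unfold Habt
  generalize t * a / Nat.gcd a (n / b) = s
  rw [← Nat.div_mul_div_comm ham hbn]
  obtain ⟨M, rfl⟩ := ham
  obtain ⟨N, rfl⟩ := hbn
  have hM : 0 < M := Nat.pos_of_mul_pos_left hm
  have hN : 0 < N := Nat.pos_of_mul_pos_left hn
  rw [Nat.mul_div_cancel_left _ hb, Nat.mul_div_cancel_left _ ha]
  let f : ℕ × ℕ → ZMod (a * M) × ZMod (b * N) := fun p =>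
    (((p.1 * a + p.2 * s : ℕ) : ZMod (a * M)), ((p.2 * b : ℕ) : ZMod (b * N)))
  have hf : Set.InjOn f (Finset.range M ×ˢ Finset.range N : Finset (ℕ × ℕ)) := by
    rintro ⟨i, j⟩ hp ⟨i', j'⟩ hp' h
    simp only [Finset.coe_product, Set.mem_prod, Finset.coe_range, Set.mem_Iio] at hp hp'
    obtain ⟨h1, h2⟩ := Prod.ext_iff.1 h
    dsimp only [f] at h1 h2
    rw [ZMod.natCast_eq_natCast_iff] at h1 h2
    have hj : j = j' := by
      rw [mul_comm j, mul_comm j'] at h2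
      exact Nat.ModEq.eq_of_lt_of_lt (Nat.ModEq.mul_left_cancel' hb.ne' h2) hp.2 hp'.2
    subst hj
    have h3 := Nat.ModEq.add_right_cancel' _ h1
    rw [mul_comm i, mul_comm i'] at h3
    rw [Nat.ModEq.eq_of_lt_of_lt (Nat.ModEq.mul_left_cancel' ha.ne' h3) hp.1 hp'.1]
  have himage : {x | ∃ i j : ℕ, i ≤ M - 1 ∧ j ≤ N - 1 ∧
      x = (((i * a + j * s : ℕ) : ZMod (a * M)), ((j * b : ℕ) : ZMod (b * N)))} =
      f '' (Finset.range M ×ˢ Finset.range N : Finset (ℕ × ℕ)) := by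
    ext x
    constructor
    · rintro ⟨i, j, hi, hj, rfl⟩
      refine ⟨(i, j), ?_, rfl⟩
      simp only [Finset.coe_product, Set.mem_prod, Finset.coe_range, Set.mem_Iio]
      omega
    · rintro ⟨⟨i, j⟩, hp, rfl⟩
      simp only [Finset.coe_product, Set.mem_prod, Finset.coe_range, Set.mem_Iio] at hp
      exact ⟨i, j, by omega, by omega, rfl⟩
  rw [himage, hf.ncard_image, Set.ncard_coe_finset, Finset.card_product,
    Finset.card_range, Finset.card_range]

theorem Habt_injOn {m n : ℕ} (hm : 0 < m) (hn : 0 < n) :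
    Set.InjOn (fun p : ℕ × ℕ × ℕ => Habt m n p.1 p.2.1 p.2.2) (Imn m n) := by
  rintro ⟨a, b, t⟩ ⟨ha, hb, ham, hbn, ht⟩ ⟨a', b', t'⟩ ⟨ha', hb', ham', hbn', ht'⟩ h
  dsimp only at *
  have key := intCast_mem_Habt_iff t hm hn ham hbn
  have key' := intCast_mem_Habt_iff t' hm hn ham' hbn'
  rw [← h] at key'
  have hiff := fun x y => (key x y).symm.trans (key' x y)
  have hfst : ∀ {c d : ℕ} {s : ℕ} (_ : 0 < d) (x : ℤ),
      (∃ v : ℤ, 0 = v * d ∧ (c : ℤ) ∣ x - v * s) ↔ (c : ℤ) ∣ x := by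
    intro c d s hd x
    constructor
    · rintro ⟨v, hv, hx⟩
      have hv0 : v = 0 := by
        rcases mul_eq_zero.1 hv.symm with h | h
        · exact h
        · omega
      simpa [hv0] using hx
    · exact fun hx => ⟨0, by simp, by simpa using hx⟩
  have ha_eq : a = a' := by
    have h0 := fun x => (hfst hb x).symm.trans ((hiff x 0).trans (hfst hb' x))
    exact Nat.dvd_antisymm (Int.natCast_dvd_natCast.1 ((h0 a').2 dvd_rfl))
      (Int.natCast_dvd_natCast.1 ((h0 a).1 dvd_rfl))
  subst ha_eq
  have hb_eq : b = b' := by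
    obtain ⟨v, hv, -⟩ := (hiff _ b).1 ⟨1, by simp, by rw [one_mul, sub_self]; exact dvd_zero _⟩
    obtain ⟨w, hw, -⟩ := (hiff _ b').2 ⟨1, by simp, by rw [one_mul, sub_self]; exact dvd_zero _⟩
    exact Nat.dvd_antisymm (Int.natCast_dvd_natCast.1 ⟨w, by rw [hw, mul_comm]⟩)
      (Int.natCast_dvd_natCast.1 ⟨v, by rw [hv, mul_comm]⟩)
  subst hb_eq
  obtain ⟨v, hv, hdvd⟩ :=
    (hiff _ b).1 ⟨1, by simp, by rw [one_mul, sub_self]; exact dvd_zero _⟩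
  have hv1 : v = 1 := by
    have hb0 : (b : ℤ) ≠ 0 := by exact_mod_cast hb.ne'
    exact mul_right_cancel₀ hb0 (by rw [← hv, one_mul])
  rw [hv1, one_mul] at hdvd
  have hmod := (Nat.modEq_iff_dvd.2 hdvd).eq_of_lt_of_lt (shift_lt ha ht') (shift_lt ha ht)
  rw [shift_injective ha hmod]

theorem exists_mem_Imn_Habt_eq {m n : ℕ} (hm : 0 < m) (hn : 0 < n)
    (H : AddSubgroup (ZMod m × ZMod n)) :
    ∃ p ∈ Imn m n, Habt m n p.1 p.2.1 p.2.2 = (H : Set (ZMod m × ZMod n)) := by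
  obtain ⟨a, hA⟩ := exists_nat_generator_of_int
    (H.comap ((AddMonoidHom.inl (ZMod m) (ZMod n)).comp (Int.castAddHom (ZMod m))))
  obtain ⟨b, hB⟩ := exists_nat_generator_of_int
    ((H.map (AddMonoidHom.snd (ZMod m) (ZMod n))).comap (Int.castAddHom (ZMod n)))
  replace hA : ∀ x : ℤ, ((x : ZMod m), (0 : ZMod n)) ∈ H ↔ (a : ℤ) ∣ x := hA
  have ham : a ∣ m := by
    refine Int.natCast_dvd_natCast.1 ((hA m).1 ?_)
    rw [Int.cast_natCast, ZMod.natCast_self]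
    exact H.zero_mem
  have hbn : b ∣ n := by
    refine Int.natCast_dvd_natCast.1 ((hB n).1 ?_)
    simp [AddSubgroup.mem_comap]
  have ha := Nat.pos_of_dvd_of_pos ham hm
  have hb := Nat.pos_of_dvd_of_pos hbn hn
  obtain ⟨s, hsa, hsb⟩ : ∃ s : ℕ, s < a ∧ ((s : ZMod m), (b : ZMod n)) ∈ H := by
    obtain ⟨⟨z, w⟩, hz, hw⟩ := (hB b).2 dvd_rfl
    obtain ⟨x, rfl⟩ := ZMod.intCast_surjective z
    obtain ⟨s, hs, q, rfl⟩ := exists_nat_mod_eq x ha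
    refine ⟨s, by omega, ?_⟩
    have h1 := H.sub_mem hz ((hA (a * q)).2 (dvd_mul_right _ _))
    have hw' : w = (b : ZMod n) := by simpa using hw
    simpa [hw'] using h1
  have hmul : ∀ v : ℤ, (((v * s : ℤ) : ZMod m), ((v * b : ℤ) : ZMod n)) ∈ H := by
    intro v
    simpa using H.zsmul_mem hsb v
  have hdvd : a ∣ (n / b) * s := by
    have h1 := hmul (n / b : ℕ)
    have h2 : (((n / b : ℕ) : ℤ) * b) = (n : ℤ) := by exact_mod_cast Nat.div_mul_cancel hbn
    rw [h2, Int.cast_natCast n, ZMod.natCast_self, hA] at h1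
    exact_mod_cast h1
  obtain ⟨t, ht, hts⟩ := exists_shift_eq ha hsa hdvd
  refine ⟨(a, b, t), ⟨ha, hb, ham, hbn, ht⟩, ?_⟩
  ext z
  obtain ⟨x, y, rfl⟩ := exists_intCast_prod z
  rw [intCast_mem_Habt_iff t hm hn ham hbn, hts, SetLike.mem_coe]
  constructor
  · rintro ⟨v, rfl, hx⟩
    simpa using H.add_mem ((hA _).2 hx) (hmul v)
  · intro h
    obtain ⟨v, rfl⟩ := (hB y).1 ⟨_, h, rfl⟩
    refine ⟨v, mul_comm _ _, (hA _).1 ?_⟩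
    have := H.sub_mem h (hmul v)
    simpa [mul_comm] using this

theorem subgroups_of_ZmxZn_representation (m n : ℕ) (hm : 0 < m) (hn : 0 < n) :
    (∀ p ∈ Imn m n,
      (∃ H : AddSubgroup (ZMod m × ZMod n),
          (H : Set (ZMod m × ZMod n)) = Habt m n p.1 p.2.1 p.2.2) ∧
      (Habt m n p.1 p.2.1 p.2.2).ncard = m * n / (p.1 * p.2.1)) ∧
    Set.BijOn (fun p : ℕ × ℕ × ℕ => Habt m n p.1 p.2.1 p.2.2) (Imn m n)
      {S : Set (ZMod m × ZMod n) |
        ∃ H : AddSubgroup (ZMod m × ZMod n), (H : Set (ZMod m × ZMod n)) = S} := by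
  refine ⟨?_, ?_, Habt_injOn hm hn, ?_⟩
  · rintro ⟨a, b, t⟩ ⟨-, -, ham, hbn, -⟩
    exact ⟨exists_addSubgroup_coe_eq_Habt t hm hn ham hbn, ncard_Habt t hm hn ham hbn⟩
  · rintro ⟨a, b, t⟩ ⟨-, -, ham, hbn, -⟩
    exact exists_addSubgroup_coe_eq_Habt t hm hn ham hbn
  · rintro S ⟨H, rfl⟩
    exact exists_mem_Imn_Habt_eq hm hn H
end

section
/- Let m and n be positive integers and let (a,b,t) ∈ I_{m,n}. With s := t·a/gcd(a, n/b), set α := gcd(m/a, n/b, n·s/(a·b)) and β := m·n/(a·b·α). Then α divides β and the subgroup H_{a,b,t} of ℤ_m × ℤ_n is isomorphic (as a group) to ℤ_α × ℤ_β. -/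
/-- If `M`, `N`, `u` have no common prime factor, some `u + k * M` is coprime to `N`. -/
theorem exists_add_mul_coprime {M N u : ℕ} (hN : N ≠ 0)
    (h : Nat.gcd M (Nat.gcd N u) = 1) : ∃ k : ℕ, Nat.Coprime (u + k * M) N := by
  refine ⟨∏ p ∈ N.primeFactors with ¬ p ∣ u, p, Nat.Coprime.symm ?_⟩
  refine Nat.coprime_of_dvd fun p hp hpN hpu => ?_
  by_cases hu : p ∣ u
  · rcases hp.dvd_mul.1 ((Nat.dvd_add_right hu).1 hpu) with hk | hM
    · obtain ⟨q, hq, hpq⟩ := (hp.prime.dvd_finsetProd_iff _).1 hk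
      simp only [Finset.mem_filter, Nat.mem_primeFactors] at hq
      rw [(Nat.prime_dvd_prime_iff_eq hp hq.1.1).1 hpq] at hu
      exact hq.2 hu
    · exact hp.one_lt.ne' (Nat.dvd_one.1 (h ▸ Nat.dvd_gcd hM (Nat.dvd_gcd hpN hu)))
  · refine hu ((Nat.dvd_add_left (Dvd.dvd.mul_right (Finset.dvd_prod_of_mem _ ?_) M)).1 hpu)
    simp [hp, hpN, hN, hu]

/-- Additive homomorphisms out of `ℤ × ℤ` given by the images of the standard generators. -/
def homOfPair {A : Type*} [AddCommGroup A] (v w : A) : ℤ × ℤ →+ A :=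
  ((zmultiplesHom A) v).coprod ((zmultiplesHom A) w)

theorem homOfPair_apply {A : Type*} [AddCommGroup A] (v w : A) (z : ℤ × ℤ) :
    homOfPair v w z = z.1 • v + z.2 • w := by
  simp [homOfPair]

/-- The quotient of `ℤ × ℤ` by the lattice spanned by `(M, 0)` and `(-u, N)` has invariant factors
`gcd M N u` and `M * N / gcd M N u`. -/
theorem exists_surjective_ker_lattice {M N u α M' N' u' : ℕ} (hN' : N' ≠ 0)
    (hM : M = α * M') (hN : N = α * N') (hu : u = α * u')
    (h : Nat.gcd M' (Nat.gcd N' u') = 1) :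
    ∃ f : ℤ × ℤ →+ ZMod α × ZMod (α * (M' * N')), Function.Surjective f ∧
      ∀ z, f z = 0 ↔ ∃ j : ℤ, z.2 = N * j ∧ (M : ℤ) ∣ z.1 + u * j := by
  obtain ⟨k, hk⟩ := exists_add_mul_coprime hN' h
  obtain ⟨c, d, hcd⟩ := Nat.isCoprime_iff_coprime.2 hk
  set w : ℤ := ((u' + k * M' : ℕ) : ℤ) with hw
  have hw' : w = u' + k * M' := by rw [hw]; push_cast; ring
  obtain ⟨f, hf⟩ : ∃ f : ℤ × ℤ →+ ZMod α × ZMod (α * (M' * N')), ∀ z, f z =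
      (((-c * z.1 + d * z.2 : ℤ) : ZMod α),
        ((N' * z.1 + w * z.2 : ℤ) : ZMod (α * (M' * N')))) := by
    refine ⟨homOfPair (((-c : ℤ) : ZMod α), ((N' : ℤ) : ZMod (α * (M' * N'))))
      (((d : ℤ) : ZMod α), ((w : ℤ) : ZMod (α * (M' * N')))), fun z => ?_⟩
    rw [homOfPair_apply]
    ext <;> simp [mul_comm]
  refine ⟨f, ?_, fun z => ?_⟩
  · rintro ⟨p, q⟩
    obtain ⟨p, rfl⟩ := ZMod.intCast_surjective p
    obtain ⟨q, rfl⟩ := ZMod.intCast_surjective q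
    refine ⟨(d * q - w * p, c * q + N' * p), ?_⟩
    rw [hf]
    ext
    · refine congrArg (Int.cast : ℤ → ZMod _) ?_
      linear_combination p * hcd
    · refine congrArg (Int.cast : ℤ → ZMod _) ?_
      linear_combination q * hcd
  · obtain ⟨x, y⟩ := z
    rw [hf, Prod.mk_eq_zero, ZMod.intCast_zmod_eq_zero_iff_dvd,
      ZMod.intCast_zmod_eq_zero_iff_dvd]
    subst hM hN hu
    push_cast
    constructor
    · rintro ⟨⟨q, hq⟩, ⟨p, hp⟩⟩
      refine ⟨c * M' * p + q, ?_, d * N' * p - k * q + u' * c * p, ?_⟩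
      · linear_combination c * hp + N' * hq - y * hcd
      · linear_combination d * hp - w * hq - x * hcd - α * q * hw'
    · rintro ⟨j, hj, i, hi⟩
      refine ⟨⟨-c * (M' * i - u' * j) + d * N' * j, ?_⟩, ⟨i + k * j, ?_⟩⟩
      · linear_combination -c * hi + d * hj
      · linear_combination N' * hi + w * hj + α * N' * j * hw'

theorem homOfPair_eq_zero_iff {a b M N s u : ℕ} (ha : 0 < a) (hb : 0 < b) (hs : N * s = u * a)
    (z : ℤ × ℤ) :
    homOfPair (A := ZMod (a * M) × ZMod (b * N)) ((a : ZMod (a * M)), 0)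
      ((s : ZMod (a * M)), (b : ZMod (b * N))) z = 0 ↔
      ∃ j : ℤ, z.2 = N * j ∧ (M : ℤ) ∣ z.1 + u * j := by
  obtain ⟨x, y⟩ := z
  have ha' : (a : ℤ) ≠ 0 := by positivity
  have hb' : (b : ℤ) ≠ 0 := by positivity
  have hs' : (N : ℤ) * s = u * a := by exact_mod_cast hs
  have hz : homOfPair (A := ZMod (a * M) × ZMod (b * N)) ((a : ZMod (a * M)), 0)
      ((s : ZMod (a * M)), (b : ZMod (b * N))) (x, y) =
      (((a * x + s * y : ℤ) : ZMod (a * M)), ((b * y : ℤ) : ZMod (b * N))) := by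
    rw [homOfPair_apply]
    ext <;> simp [mul_comm]
  rw [hz, Prod.mk_eq_zero, ZMod.intCast_zmod_eq_zero_iff_dvd,
    ZMod.intCast_zmod_eq_zero_iff_dvd]
  push_cast
  rw [mul_dvd_mul_iff_left hb']
  have key : ∀ j : ℤ, a * x + s * (N * j) = a * (x + u * j) := fun j => by
    linear_combination j * hs'
  constructor
  · rintro ⟨h, j, rfl⟩
    rw [key, mul_dvd_mul_iff_left ha'] at h
    exact ⟨j, rfl, h⟩
  · rintro ⟨j, rfl, h⟩
    rw [key, mul_dvd_mul_iff_left ha']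
    exact ⟨h, j, rfl⟩

theorem range_homOfPair {a b M N s u : ℕ} (hM : 0 < M) (hN : 0 < N) (hs : N * s = u * a) :
    Set.range (homOfPair (A := ZMod (a * M) × ZMod (b * N)) ((a : ZMod (a * M)), 0)
      ((s : ZMod (a * M)), (b : ZMod (b * N)))) =
      {x | ∃ i j : ℕ, i ≤ M - 1 ∧ j ≤ N - 1 ∧
        x = (((i * a + j * s : ℕ) : ZMod (a * M)), ((j * b : ℕ) : ZMod (b * N)))} := by
  have hs' : (N : ℤ) * s = u * a := by exact_mod_cast hs
  have hM' : (M : ℤ) ≠ 0 := by positivity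
  have hN' : (N : ℤ) ≠ 0 := by positivity
  ext z
  constructor
  · rintro ⟨⟨x, y⟩, rfl⟩
    obtain ⟨j, hj⟩ := Int.eq_ofNat_of_zero_le (Int.emod_nonneg y hN')
    obtain ⟨i, hi⟩ := Int.eq_ofNat_of_zero_le (Int.emod_nonneg (x + u * (y / N)) hM')
    have hjN := Int.emod_lt_of_pos y (by positivity : (0 : ℤ) < N)
    have hiM := Int.emod_lt_of_pos (x + u * (y / N)) (by positivity : (0 : ℤ) < M)
    have ey := Int.emod_add_mul_ediv y N
    have ex := Int.emod_add_mul_ediv (x + u * (y / N)) M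
    rw [hj] at hjN ey
    rw [hi] at hiM ex
    refine ⟨i, j, by omega, by omega, ?_⟩
    rw [homOfPair_apply]
    ext
    · have : ((x * a + y * s : ℤ) : ZMod (a * M)) = ((i * a + j * s : ℤ) : ZMod (a * M)) := by
        rw [ZMod.intCast_eq_intCast_iff_dvd_sub]
        refine ⟨-((x + u * (y / N)) / M), ?_⟩
        push_cast
        linear_combination a * ex + s * ey - (y / N) * hs'
      simpa using this
    · have : ((y * b : ℤ) : ZMod (b * N)) = ((j * b : ℤ) : ZMod (b * N)) := by
        rw [ZMod.intCast_eq_intCast_iff_dvd_sub]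
        refine ⟨-(y / N), ?_⟩
        push_cast
        linear_combination b * ey
      simpa using this
  · rintro ⟨i, j, -, -, rfl⟩
    refine ⟨(i, j), ?_⟩
    rw [homOfPair_apply]
    ext <;> simp

theorem invariant_factor_decomposition (m n a b t : ℕ) (hm : 0 < m) (hn : 0 < n)
    (hmem : (a, b, t) ∈ Imn m n)
    (H : AddSubgroup (ZMod m × ZMod n))
    (hH : (H : Set (ZMod m × ZMod n)) = Habt m n a b t)
    (s α β : ℕ)
    (hs : s = t * a / Nat.gcd a (n / b))
    (hα : α = Nat.gcd (m / a) (Nat.gcd (n / b) (n * s / (a * b))))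
    (hβ : β = m * n / (a * b * α)) :
    α ∣ β ∧ Nonempty (H ≃+ ZMod α × ZMod β) := by
  obtain ⟨ha, hb, ⟨M, rfl⟩, ⟨N, rfl⟩, -⟩ := hmem
  dsimp only at ha hb hm hn hH hs hα hβ H ⊢
  have hM : 0 < M := Nat.pos_of_mul_pos_left hm
  have hN : 0 < N := Nat.pos_of_mul_pos_left hn
  unfold Habt at hH
  rw [← hs] at hH
  rw [Nat.mul_div_cancel_left _ ha, Nat.mul_div_cancel_left _ hb] at hH hα
  rw [Nat.mul_div_cancel_left _ hb] at hs
  obtain ⟨u, hu⟩ : ∃ u, N * s = u * a := by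
    obtain ⟨a', ha'⟩ := Nat.gcd_dvd_left a N
    obtain ⟨N', hN'⟩ := Nat.gcd_dvd_right a N
    have hg : 0 < Nat.gcd a N := Nat.gcd_pos_of_pos_left _ ha
    have hs' : s = t * a' := by
      rw [hs]
      refine Nat.div_eq_of_eq_mul_right hg ?_
      rw [mul_left_comm, ← ha']
    refine ⟨N' * t, ?_⟩
    generalize Nat.gcd a N = g at *
    rw [hs', ha', hN']
    ring
  have hu' : b * N * s / (a * b) = u := by
    refine Nat.div_eq_of_eq_mul_right (by positivity) ?_
    rw [mul_assoc, hu]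
    ring
  rw [hu'] at hα
  have hαpos : 0 < α := hα ▸ Nat.gcd_pos_of_pos_left _ hM
  obtain ⟨M', hM'⟩ : α ∣ M := hα ▸ Nat.gcd_dvd_left _ _
  obtain ⟨N', hN'⟩ : α ∣ N := hα ▸ (Nat.gcd_dvd_right _ _).trans (Nat.gcd_dvd_left _ _)
  obtain ⟨u', huα⟩ : α ∣ u := hα ▸ (Nat.gcd_dvd_right _ _).trans (Nat.gcd_dvd_right _ _)
  have hcop : Nat.gcd M' (Nat.gcd N' u') = 1 := by
    rw [hM', hN', huα, Nat.gcd_mul_left, Nat.gcd_mul_left] at hα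
    exact Nat.eq_of_mul_eq_mul_left hαpos (by rw [← hα, mul_one])
  have hN'0 : N' ≠ 0 := by
    rintro rfl
    omega
  have hβ' : β = α * (M' * N') := by
    rw [hβ]
    refine Nat.div_eq_of_eq_mul_right (by positivity) ?_
    rw [hM', hN']
    ring
  subst hβ'
  refine ⟨Dvd.intro _ rfl, ?_⟩
  obtain ⟨f, hf, hker⟩ := exists_surjective_ker_lattice hN'0 hM' hN' huα hcop
  set g := homOfPair (A := ZMod (a * M) × ZMod (b * N)) ((a : ZMod (a * M)), 0)
      ((s : ZMod (a * M)), (b : ZMod (b * N))) with hg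
  have hrange : H = g.range := by
    apply SetLike.coe_injective
    rw [hH, AddMonoidHom.coe_range, hg, range_homOfPair hM hN hu]
  have hkers : g.ker = f.ker := by
    ext z
    rw [AddMonoidHom.mem_ker, AddMonoidHom.mem_ker, hker, hg, homOfPair_eq_zero_iff ha hb hu]
  exact ⟨(AddEquiv.addSubgroupCongr hrange).trans
    ((QuotientAddGroup.quotientKerEquivRange g).symm.trans
      ((QuotientAddGroup.quotientAddEquivOfEq hkers).trans
        (QuotientAddGroup.quotientKerEquivOfSurjective f hf)))⟩
end

section
/- Let m and n be positive integers and let (a,b,t) ∈ I_{m,n}. With s := t·a/gcd(a, n/b), set α := gcd(m/a, n/b, n·s/(a·b)) and β := m·n/(a·b·α). Then the exponent of the subgroup H_{a,b,t} of ℤ_m × ℤ_n equals β. -/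
theorem dvd_and_dvd_and_dvd_mul_iff_div_gcd_dvd {M N u : ℕ} (hM : 0 < M) {k a s : ℕ}
    (ha : 0 < a) (hu : N * s = a * u) :
    M ∣ k ∧ N ∣ k ∧ a * M ∣ k * s ↔ M * N / Nat.gcd M (Nat.gcd N u) ∣ k := by
  set d := Nat.gcd M (Nat.gcd N u) with hd
  have hdpos : 0 < d := Nat.gcd_pos_of_pos_left _ hM
  obtain ⟨M', hM'⟩ : d ∣ M := Nat.gcd_dvd_left _ _
  obtain ⟨N', hN'⟩ : d ∣ N := (Nat.gcd_dvd_right _ _).trans (Nat.gcd_dvd_left _ _)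
  obtain ⟨u', hu'⟩ : d ∣ u := (Nat.gcd_dvd_right _ _).trans (Nat.gcd_dvd_right _ _)
  have hdiv : M * N / d = M' * N := by
    rw [hM', mul_assoc, Nat.mul_div_cancel_left _ hdpos]
  rw [hdiv]
  constructor
  · rintro ⟨h1, ⟨l, rfl⟩, h3⟩
    have hMu : M ∣ l * u := by
      have h : a * M ∣ a * (l * u) := by
        have e : a * (l * u) = N * l * s := by linear_combination l * hu.symm
        rwa [e]
      exact Nat.dvd_of_mul_dvd_mul_left ha h
    have hMd : M ∣ l * d := by
      rw [hd, ← Nat.gcd_mul_left, ← Nat.gcd_mul_left]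
      exact Nat.dvd_gcd (dvd_mul_left _ _) (Nat.dvd_gcd (by rwa [mul_comm]) hMu)
    rw [mul_comm N l]
    refine mul_dvd_mul_right (Nat.dvd_of_mul_dvd_mul_left hdpos ?_) N
    rwa [← hM', mul_comm d l]
  · rintro ⟨l, rfl⟩
    refine ⟨⟨N' * l, ?_⟩, ⟨M' * l, by ring⟩, ⟨u' * l, ?_⟩⟩
    · calc M' * N * l = M' * (d * N') * l := by rw [← hN']
        _ = d * M' * (N' * l) := by ring
        _ = M * (N' * l) := by rw [← hM']
    · calc M' * N * l * s = M' * l * (N * s) := by ring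
        _ = M' * l * (a * (d * u')) := by rw [hu, ← hu']
        _ = a * (d * M') * (u' * l) := by ring
        _ = a * M * (u' * l) := by rw [← hM']

theorem forall_mem_Habt_nsmul_eq_zero_iff {a b M N t : ℕ} (ha : 0 < a) (hb : 0 < b)
    (hM : 0 < M) (hN : 0 < N) (ht : t ≤ Nat.gcd a N - 1) (k : ℕ) :
    (∀ x ∈ Habt (a * M) (b * N) a b t, k • x = 0) ↔
      M ∣ k ∧ N ∣ k ∧ a * M ∣ k * (t * a / Nat.gcd a N) := by
  simp only [Habt, Set.mem_ofPred_eq, Nat.mul_div_cancel_left _ ha, Nat.mul_div_cancel_left _ hb]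
  set s := t * a / Nat.gcd a N with hs
  have key : ∀ i j : ℕ, k • (((i * a + j * s : ℕ) : ZMod (a * M)), ((j * b : ℕ) : ZMod (b * N)))
      = 0 ↔ a * M ∣ k * (i * a + j * s) ∧ b * N ∣ k * (j * b) := by
    intro i j
    rw [Prod.smul_mk, Prod.mk_eq_zero, nsmul_eq_mul, nsmul_eq_mul, ← Nat.cast_mul, ← Nat.cast_mul,
      ZMod.natCast_eq_zero_iff, ZMod.natCast_eq_zero_iff]
  constructor
  · intro h
    refine ⟨?_, ?_⟩
    · rcases Nat.eq_or_lt_of_le (Nat.succ_le_of_lt hM) with hM1 | hM1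
      · rw [← hM1]; exact one_dvd _
      · have h1 := ((key 1 0).1 (h _ ⟨1, 0, by omega, by omega, rfl⟩)).1
        refine Nat.dvd_of_mul_dvd_mul_left ha ?_
        simpa [mul_comm k a] using h1
    · rcases Nat.eq_or_lt_of_le (Nat.succ_le_of_lt hN) with hN1 | hN1
      · have hN' : N = 1 := hN1.symm
        have hs0 : s = 0 := by
          subst hN'
          have : t = 0 := by simpa using ht
          simp [hs, this]
        simp [hs0, hN']
      · have h1 := (key 0 1).1 (h _ ⟨0, 1, by omega, by omega, rfl⟩)
        refine ⟨Nat.dvd_of_mul_dvd_mul_left hb ?_, ?_⟩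
        · simpa [mul_comm k b] using h1.2
        · simpa using h1.1
  · rintro ⟨h1, h2, h3⟩ x ⟨i, j, -, -, rfl⟩
    refine (key i j).2 ⟨?_, ?_⟩
    · have e : k * (i * a + j * s) = a * k * i + k * s * j := by ring
      rw [e]
      exact dvd_add ((mul_dvd_mul_left a h1).mul_right i) (h3.mul_right j)
    · have e : k * (j * b) = b * k * j := by ring
      rw [e]
      exact (mul_dvd_mul_left b h2).mul_right j

theorem exponent_of_Habt (m n a b t : ℕ) (hm : 0 < m) (hn : 0 < n)
    (hmem : (a, b, t) ∈ Imn m n)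
    (H : AddSubgroup (ZMod m × ZMod n))
    (hH : (H : Set (ZMod m × ZMod n)) = Habt m n a b t)
    (s α β : ℕ)
    (hs : s = t * a / Nat.gcd a (n / b))
    (hα : α = Nat.gcd (m / a) (Nat.gcd (n / b) (n * s / (a * b))))
    (hβ : β = m * n / (a * b * α)) :
    AddMonoid.exponent H = β := by
  obtain ⟨ha, hb, ⟨M, rfl⟩, ⟨N, rfl⟩, ht⟩ := hmem
  dsimp only at ha hb ht hH
  have hM : 0 < M := Nat.pos_of_mul_pos_left hm
  have hN : 0 < N := Nat.pos_of_mul_pos_left hn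
  rw [Nat.mul_div_cancel_left _ hb] at ht hs hα
  rw [Nat.mul_div_cancel_left _ ha] at hα
  obtain ⟨u, hu⟩ : a ∣ N * s := by
    obtain ⟨c, hc⟩ := Nat.gcd_dvd_left a N
    obtain ⟨d, hd⟩ := Nat.gcd_dvd_right a N
    have hg : 0 < Nat.gcd a N := Nat.gcd_pos_of_pos_left _ ha
    have hs' : s = t * c := by
      rw [hs]
      refine Nat.div_eq_of_eq_mul_right hg ?_
      linear_combination t * hc
    exact ⟨d * t, by rw [hs']; linear_combination t * c * hd - d * t * hc⟩
  have hu' : b * N * s / (a * b) = u := by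
    refine Nat.div_eq_of_eq_mul_right (Nat.mul_pos ha hb) ?_
    linear_combination b * hu
  have hβ' : β = M * N / α := by
    rw [hβ, ← Nat.mul_div_mul_left (M * N) α (Nat.mul_pos ha hb)]
    congr 1
    ring
  rw [hu'] at hα
  have hdvd : ∀ k, AddMonoid.exponent H ∣ k ↔ β ∣ k := by
    intro k
    rw [hβ', hα, ← dvd_and_dvd_and_dvd_mul_iff_div_gcd_dvd hM ha hu, hs,
      ← forall_mem_Habt_nsmul_eq_zero_iff ha hb hM hN ht, ← hH,
      AddMonoid.exponent_dvd_iff_forall_nsmul_eq_zero]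
    simp [Subtype.ext_iff]
  exact Nat.dvd_antisymm ((hdvd β).2 dvd_rfl) ((hdvd _).1 dvd_rfl)
end

section
/- Let m and n be positive integers and let (a,b,t) ∈ I_{m,n}. With s := t·a/gcd(a, n/b), set α := gcd(m/a, n/b, n·s/(a·b)). Then the subgroup H_{a,b,t} of ℤ_m × ℤ_n is cyclic if and only if α = 1. -/
theorem Nat.exists_coprime_add_mul {c M N : ℕ} (hM : M ≠ 0)
    (h : Nat.gcd M (Nat.gcd N c) = 1) : ∃ k : ℕ, (c + k * N).Coprime M := by
  let ps : Finset ℕ := {p ∈ M.primeFactors | ¬p ∣ c}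
  refine ⟨ps.prod id, Nat.coprime_of_dvd fun p pp hp hpM => ?_⟩
  by_cases hpc : p ∣ c
  · have hdvd : p ∣ ps.prod id * N := (Nat.dvd_add_right hpc).mp hp
    rcases pp.dvd_mul.mp hdvd with hk | hN
    · obtain ⟨q, hq, hpq⟩ := (pp.prime.dvd_finsetProd_iff id).mp hk
      rw [Finset.mem_filter, Nat.mem_primeFactors] at hq
      have hpq' : p = q := (Nat.prime_dvd_prime_iff_eq pp hq.1.1).mp hpq
      exact hq.2 (hpq' ▸ hpc)
    · exact pp.not_dvd_one (h ▸ Nat.dvd_gcd hpM (Nat.dvd_gcd hN hpc))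
  · have hps : p ∈ ps :=
      Finset.mem_filter.mpr ⟨Nat.mem_primeFactors.mpr ⟨pp, hpM, hM⟩, hpc⟩
    exact hpc ((Nat.dvd_add_left ((Finset.dvd_prod_of_mem id hps).mul_right N)).mp hp)

theorem exists_mem_zmultiples_of_gcd_eq_one {G : Type*} [AddCommGroup G] {u v : G}
    {c M N : ℕ} (hM : M ≠ 0) (hu : M • u = 0) (hv : N • v = c • u)
    (h : Nat.gcd M (Nat.gcd N c) = 1) :
    ∃ w : G, u ∈ AddSubgroup.zmultiples w ∧ v ∈ AddSubgroup.zmultiples w := by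
  obtain ⟨k, hk⟩ := Nat.exists_coprime_add_mul hM h
  have hw : N • (v + k • u) = (c + k * N) • u := by
    rw [smul_add, hv, add_smul, ← mul_smul, mul_comm]
  have hu_mem : u ∈ AddSubgroup.zmultiples (v + k • u) := by
    obtain ⟨x, y, hxy⟩ := Nat.isCoprime_iff_coprime.mpr hk
    have hu1 : x • (N • (v + k • u)) = u := by
      have hsum : u = x • ((c + k * N) • u) + y • (M • u) := by
        rw [← natCast_zsmul u, ← natCast_zsmul u, ← mul_smul, ← mul_smul, ← add_smul, hxy, one_smul]
      rw [hw, eq_comm]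
      rwa [hu, smul_zero, add_zero] at hsum
    have hmem := zsmul_mem (nsmul_mem (AddSubgroup.mem_zmultiples (v + k • u)) N) x
    rwa [hu1] at hmem
  refine ⟨v + k • u, hu_mem, ?_⟩
  have hsub := sub_mem (AddSubgroup.mem_zmultiples (v + k • u)) (nsmul_mem hu_mem k)
  rwa [add_sub_cancel_right] at hsub

theorem AddSubgroup.coprime_addOrderOf_of_isAddCyclic {A B : Type*} [AddGroup A] [AddGroup B]
    [Finite A] [Finite B] {H : AddSubgroup (A × B)} [IsAddCyclic H] {x : A} {y : B}
    (hx : (x, 0) ∈ H) (hy : (0, y) ∈ H) : (addOrderOf x).Coprime (addOrderOf y) := by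
  have hle : (zmultiples x).prod (zmultiples y) ≤ H := by
    rintro ⟨p, q⟩ ⟨hp, hq⟩
    obtain ⟨i, rfl⟩ := mem_zmultiples_iff.mp hp
    obtain ⟨j, rfl⟩ := mem_zmultiples_iff.mp hq
    have hij := add_mem (zsmul_mem hx i) (zsmul_mem hy j)
    simpa using hij
  have : IsAddCyclic ((zmultiples x).prod (zmultiples y)) :=
    isAddCyclic_of_injective (inclusion hle) (inclusion_injective hle)
  have : IsAddCyclic (zmultiples x × zmultiples y) :=
    isAddCyclic_of_injective (prodEquiv (zmultiples x) (zmultiples y)).symm.toAddMonoidHom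
      (prodEquiv (zmultiples x) (zmultiples y)).symm.injective
  simpa only [Nat.card_zmultiples] using
    coprime_card_of_isAddCyclic_prod (zmultiples x) (zmultiples y)

theorem ZMod.addOrderOf_natCast_div {m d : ℕ} (hm : m ≠ 0) (hd : d ∣ m) :
    addOrderOf ((m / d : ℕ) : ZMod m) = d := by
  rw [ZMod.addOrderOf_coe _ hm, Nat.gcd_eq_right (Nat.div_dvd_of_dvd hd), Nat.div_div_self hd hm]

theorem Habt_cyclic_iff (m n a b t : ℕ) (hm : 0 < m) (hn : 0 < n)
    (hmem : (a, b, t) ∈ Imn m n)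
    (H : AddSubgroup (ZMod m × ZMod n))
    (hH : (H : Set (ZMod m × ZMod n)) = Habt m n a b t)
    (s α : ℕ)
    (hs : s = t * a / Nat.gcd a (n / b))
    (hα : α = Nat.gcd (m / a) (Nat.gcd (n / b) (n * s / (a * b)))) :
    IsAddCyclic H ↔ α = 1 := by
  obtain ⟨ha, hb, ⟨M, hmM⟩, ⟨N, hnN⟩, ht⟩ := hmem
  dsimp only at ha hb hmM hnN ht
  have hM : m / a = M := by rw [hmM, Nat.mul_div_cancel_left _ ha]
  have hN : n / b = N := by rw [hnN, Nat.mul_div_cancel_left _ hb]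
  have hM0 : 0 < M := Nat.pos_of_mul_pos_left (hmM ▸ hm)
  have hN0 : 0 < N := Nat.pos_of_mul_pos_left (hnN ▸ hn)
  rw [hN] at hs ht
  obtain ⟨c, hc⟩ : a ∣ N * s := by
    obtain ⟨N', hN'⟩ := Nat.gcd_dvd_right a N
    have hgs : Nat.gcd a N * s = t * a := by
      rw [hs, Nat.mul_div_cancel' ((Nat.gcd_dvd_left a N).mul_left t)]
    refine ⟨N' * t, ?_⟩
    calc N * s = N' * (Nat.gcd a N * s) := by rw [← mul_assoc, mul_comm N', ← hN']
      _ = a * (N' * t) := by rw [hgs]; ring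
  have hcdef : n * s / (a * b) = c := by
    rw [hnN, mul_assoc, hc, ← mul_assoc, mul_comm b a, Nat.mul_div_cancel_left _ (by positivity)]
  rw [hM, hN, hcdef] at hα
  have mem_H (x) : x ∈ H ↔ ∃ i j : ℕ, i ≤ M - 1 ∧ j ≤ N - 1 ∧
      x = (((i * a + j * s : ℕ) : ZMod m), ((j * b : ℕ) : ZMod n)) := by
    rw [← SetLike.mem_coe, hH, Habt, hM, hN, ← hs]
    rfl
  let u : ZMod m × ZMod n := ((a : ZMod m), 0)
  let v : ZMod m × ZMod n := ((s : ZMod m), (b : ZMod n))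
  have hu : u ∈ H := by
    rcases Nat.lt_or_ge 1 M with h1 | h1
    · exact (mem_H u).mpr ⟨1, 0, by omega, by omega, by simp [u]⟩
    · have hma : m = a := by rw [hmM, show M = 1 by omega, mul_one]
      have : u = 0 := by simp [u, ← hma]
      exact this ▸ H.zero_mem
  have hv : v ∈ H := by
    rcases Nat.lt_or_ge 1 N with h1 | h1
    · exact (mem_H v).mpr ⟨0, 1, by omega, by omega, by simp [v]⟩
    · have hN1 : N = 1 := by omega
      have hnb : n = b := by rw [hnN, hN1, mul_one]
      have hs0 : s = 0 := by
        rw [hN1, Nat.gcd_one_right] at ht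
        rw [hs, show t = 0 by omega, zero_mul, Nat.zero_div]
      have : v = 0 := by simp [v, ← hnb, hs0]
      exact this ▸ H.zero_mem
  constructor
  · intro hcyc
    obtain ⟨M', hM'⟩ : α ∣ M := hα ▸ Nat.gcd_dvd_left _ _
    obtain ⟨N', hN'⟩ : α ∣ N := hα ▸ (Nat.gcd_dvd_right _ _).trans (Nat.gcd_dvd_left _ _)
    obtain ⟨c', hc'⟩ : α ∣ c := hα ▸ (Nat.gcd_dvd_right _ _).trans (Nat.gcd_dvd_right _ _)
    have hα0 : 0 < α := Nat.pos_of_mul_pos_right (hM' ▸ hM0)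
    have hmα : m / α = M' * a := by
      rw [hmM, hM']; exact Nat.div_eq_of_eq_mul_right hα0 (by ring)
    have hnα : n / α = N' * b := by
      rw [hnN, hN']; exact Nat.div_eq_of_eq_mul_right hα0 (by ring)
    have hc'' : N' * s = c' * a := by
      apply Nat.eq_of_mul_eq_mul_left hα0
      rw [← mul_assoc, ← hN', hc, hc']; ring
    have hx : (((m / α : ℕ) : ZMod m), (0 : ZMod n)) ∈ H := by
      have := nsmul_mem hu M'
      simpa [u, hmα] using this
    have hy : ((0 : ZMod m), ((n / α : ℕ) : ZMod n)) ∈ H := by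
      have := sub_mem (nsmul_mem hv N') (nsmul_mem hu c')
      have hcast : (N' : ZMod m) * s = c' * a := by exact_mod_cast congrArg Nat.cast hc''
      simpa [u, v, hnα, hcast] using this
    have : NeZero m := ⟨hm.ne'⟩
    have : NeZero n := ⟨hn.ne'⟩
    have hcop := AddSubgroup.coprime_addOrderOf_of_isAddCyclic hx hy
    rwa [ZMod.addOrderOf_natCast_div hm.ne' (hmM ▸ hM' ▸ ⟨a * M', by ring⟩),
      ZMod.addOrderOf_natCast_div hn.ne' (hnN ▸ hN' ▸ ⟨b * N', by ring⟩),
      Nat.coprime_self] at hcop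
  · intro h1
    have hMu : M • (⟨u, hu⟩ : H) = 0 := by
      have : (M : ZMod m) * a = 0 := by
        rw [← Nat.cast_mul, mul_comm, ← hmM, ZMod.natCast_self]
      ext <;> simp [u, this]
    have hNv : N • (⟨v, hv⟩ : H) = c • (⟨u, hu⟩ : H) := by
      have h1 : (N : ZMod m) * s = c * a := by
        rw [← Nat.cast_mul, hc, mul_comm, Nat.cast_mul]
      have h2 : (N : ZMod n) * b = 0 := by
        rw [← Nat.cast_mul, mul_comm, ← hnN, ZMod.natCast_self]
      ext <;> simp [u, v, h1, h2]
    obtain ⟨w, huw, hvw⟩ := exists_mem_zmultiples_of_gcd_eq_one hM0.ne' hMu hNv (hα ▸ h1)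
    refine ⟨w, fun x => ?_⟩
    obtain ⟨i, j, -, -, hx⟩ := (mem_H x).mp x.2
    have hx' : x = i • (⟨u, hu⟩ : H) + j • (⟨v, hv⟩ : H) := by
      ext <;> simp [hx, u, v]
    rw [hx']
    exact add_mem (nsmul_mem huw i) (nsmul_mem hvw j)
end

section
/- Let m and n be positive integers and let (a,b,t) ∈ I_{m,n}. The subgroup H_{a,b,t} of ℤ_m × ℤ_n is a subproduct (i.e., equals H₁ × H₂ for some subgroups H₁ ≤ ℤ_m and H₂ ≤ ℤ_n) if and only if t = 0; moreover, H_{a,b,0} is cyclic if and only if gcd(m/a, n/b) = 1. -/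
open AddSubgroup in
theorem ZMod.mem_zmultiples_natCast_iff {m a : ℕ} (hm : 0 < m) (ha : a ∣ m) (x : ZMod m) :
    x ∈ zmultiples (a : ZMod m) ↔ ∃ i ≤ m / a - 1, x = ((i * a : ℕ) : ZMod m) := by
  have : NeZero m := ⟨hm.ne'⟩
  have hpos : 0 < m / a := Nat.div_pos (Nat.le_of_dvd hm ha) (Nat.pos_of_dvd_of_pos ha hm)
  rw [mem_zmultiples_iff_mem_range_addOrderOf, ZMod.addOrderOf_coe a hm.ne',
    Nat.gcd_eq_right ha]
  simp only [Finset.mem_image, Finset.mem_range, nsmul_eq_mul, Nat.cast_mul]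
  constructor
  · rintro ⟨i, hi, rfl⟩
    exact ⟨i, by omega, rfl⟩
  · rintro ⟨i, hi, rfl⟩
    exact ⟨i, by omega, rfl⟩

theorem ZMod.card_zmultiples_natCast {m a : ℕ} (hm : 0 < m) (ha : a ∣ m) :
    Nat.card (AddSubgroup.zmultiples (a : ZMod m)) = m / a := by
  rw [Nat.card_zmultiples, ZMod.addOrderOf_coe a hm.ne', Nat.gcd_eq_right ha]

theorem Habt_zero_eq_prod {m n a b : ℕ} (hm : 0 < m) (hn : 0 < n) (ha : a ∣ m) (hb : b ∣ n) :
    Habt m n a b 0 = (AddSubgroup.zmultiples (a : ZMod m) : Set (ZMod m)) ×ˢ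
      (AddSubgroup.zmultiples (b : ZMod n) : Set (ZMod n)) := by
  ext ⟨x, y⟩
  simp only [Habt, Set.mem_ofPred_eq, Set.mem_prod, SetLike.mem_coe,
    ZMod.mem_zmultiples_natCast_iff hm ha, ZMod.mem_zmultiples_natCast_iff hn hb, Prod.mk.injEq,
    zero_mul, Nat.zero_div, mul_zero, add_zero]
  constructor
  · rintro ⟨i, j, hi, hj, hx, hy⟩
    exact ⟨⟨i, hi, hx⟩, ⟨j, hj, hy⟩⟩
  · rintro ⟨⟨i, hi, hx⟩, ⟨j, hj, hy⟩⟩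
    exact ⟨i, j, hi, hj, hx, hy⟩

theorem eq_zero_of_Habt_eq_prod {m n a b t : ℕ} (hn : 0 < n) (h : (a, b, t) ∈ Imn m n)
    {H₁ : AddSubgroup (ZMod m)} {H₂ : AddSubgroup (ZMod n)}
    (hH : Habt m n a b t = (H₁ : Set (ZMod m)) ×ˢ (H₂ : Set (ZMod n))) : t = 0 := by
  obtain ⟨ha, hb, ham, ⟨c, rfl⟩, ht⟩ := h
  dsimp only at ha hb ham ht
  simp only [Habt, Nat.mul_div_cancel_left c hb] at ht hH
  have hc : 0 < c := Nat.pos_of_mul_pos_left hn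
  obtain rfl | hc1 : c = 1 ∨ 1 < c := by omega
  · simpa using ht
  have hg : 0 < a.gcd c := Nat.gcd_pos_of_pos_left c ha
  have hsa : t * a / a.gcd c < a := by
    rw [Nat.div_lt_iff_lt_mul hg, mul_comm a]
    exact Nat.mul_lt_mul_of_pos_right (by omega) ha
  have hmem : (((0 * a + 1 * (t * a / a.gcd c) : ℕ) : ZMod m), ((1 * b : ℕ) : ZMod (b * c))) ∈
      (H₁ : Set (ZMod m)) ×ˢ (H₂ : Set (ZMod (b * c))) :=
    hH ▸ ⟨0, 1, Nat.zero_le _, by omega, rfl⟩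
  have hzero : ((0 : ZMod m), ((1 * b : ℕ) : ZMod (b * c))) ∈
      (H₁ : Set (ZMod m)) ×ˢ (H₂ : Set (ZMod (b * c))) := ⟨H₁.zero_mem, hmem.2⟩
  rw [← hH] at hzero
  obtain ⟨i, j, -, hj, hx⟩ := hzero
  obtain ⟨hx, hy⟩ := Prod.mk.inj hx
  rw [ZMod.natCast_eq_natCast_iff, mul_comm 1 b, mul_comm j b] at hy
  have hj1 : j = 1 :=
    ((Nat.ModEq.mul_left_cancel' hb.ne' hy).eq_of_lt_of_lt hc1 (by omega)).symm
  subst hj1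
  have hdvd := ham.trans ((ZMod.natCast_eq_zero_iff _ _).1 hx.symm)
  rw [one_mul, Nat.dvd_add_right (Dvd.intro_left i rfl)] at hdvd
  have hs := Nat.eq_zero_of_dvd_of_lt hdvd hsa
  rw [Nat.mul_div_assoc _ (Nat.gcd_dvd_left a c), mul_eq_zero] at hs
  exact hs.resolve_right (Nat.div_pos (Nat.gcd_le_left c ha) hg).ne'

theorem isAddCyclic_iff_of_coe_eq_Habt_zero {m n a b : ℕ} (hm : 0 < m) (hn : 0 < n)
    (ha : a ∣ m) (hb : b ∣ n) {H : AddSubgroup (ZMod m × ZMod n)}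
    (hH : (H : Set (ZMod m × ZMod n)) = Habt m n a b 0) :
    IsAddCyclic H ↔ Nat.gcd (m / a) (n / b) = 1 := by
  obtain rfl : H = (AddSubgroup.zmultiples (a : ZMod m)).prod
      (AddSubgroup.zmultiples (b : ZMod n)) :=
    SetLike.coe_injective (hH.trans (Habt_zero_eq_prod hm hn ha hb))
  rw [(AddSubgroup.prodEquiv _ _).isAddCyclic, AddGroup.isAddCyclic_prod_iff,
    ZMod.card_zmultiples_natCast hm ha, ZMod.card_zmultiples_natCast hn hb]
  exact ⟨fun h => h.2.2, fun h => ⟨inferInstance, inferInstance, h⟩⟩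

theorem Habt_subproduct_iff (m n a b t : ℕ) (hm : 0 < m) (hn : 0 < n)
    (hmem : (a, b, t) ∈ Imn m n)
    (H : AddSubgroup (ZMod m × ZMod n))
    (hH : (H : Set (ZMod m × ZMod n)) = Habt m n a b t)
    (H₀ : AddSubgroup (ZMod m × ZMod n))
    (hH₀ : (H₀ : Set (ZMod m × ZMod n)) = Habt m n a b 0) :
    ((∃ H₁ : AddSubgroup (ZMod m), ∃ H₂ : AddSubgroup (ZMod n),
        (H : Set (ZMod m × ZMod n)) = (H₁ : Set (ZMod m)) ×ˢ (H₂ : Set (ZMod n))) ↔ t = 0) ∧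
    (IsAddCyclic H₀ ↔ Nat.gcd (m / a) (n / b) = 1) := by
  have ham : a ∣ m := hmem.2.2.1
  have hbn : b ∣ n := hmem.2.2.2.1
  refine ⟨⟨?_, ?_⟩, isAddCyclic_iff_of_coe_eq_Habt_zero hm hn ham hbn hH₀⟩
  · rintro ⟨H₁, H₂, h⟩
    exact eq_zero_of_Habt_eq_prod hn hmem (hH.symm.trans h)
  · rintro rfl
    exact ⟨_, _, hH.trans (Habt_zero_eq_prod hm hn ham hbn)⟩
end

section
/- Let p be a prime and let a, b be integers with 0 ≤ a ≤ b. The total number of subgroups of ℤ_{p^a} × ℤ_{p^b} equals ((b−a+1)·p^{a+2} − (b−a−1)·p^{a+1} − (a+b+3)·p + (a+b+1)) / (p−1)². -/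
section Goursat

variable {A B : Type*} [AddCommGroup A] [AddCommGroup B]

/-- The subgroup of `A × B` with first projection `G` that is the preimage of the graph of
`f : G →+ B ⧸ K`. -/
def AddSubgroup.ofQuotientHom (G : AddSubgroup A) (K : AddSubgroup B) (f : G →+ B ⧸ K) :
    AddSubgroup (A × B) where
  carrier := {x | ∃ h : x.1 ∈ G, f ⟨x.1, h⟩ = (x.2 : B ⧸ K)}
  zero_mem' := ⟨G.zero_mem, f.map_zero⟩
  add_mem' := by
    rintro x y ⟨hx, hfx⟩ ⟨hy, hfy⟩
    refine ⟨G.add_mem hx hy, ?_⟩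
    rw [Prod.snd_add, QuotientAddGroup.mk_add, ← hfx, ← hfy, ← map_add]
    rfl
  neg_mem' := by
    rintro x ⟨hx, hfx⟩
    refine ⟨G.neg_mem hx, ?_⟩
    rw [Prod.snd_neg, QuotientAddGroup.mk_neg, ← hfx, ← map_neg]
    rfl

theorem AddSubgroup.mem_ofQuotientHom {G : AddSubgroup A} {K : AddSubgroup B} {f : G →+ B ⧸ K}
    {x : A × B} :
    x ∈ AddSubgroup.ofQuotientHom G K f ↔ ∃ h : x.1 ∈ G, f ⟨x.1, h⟩ = (x.2 : B ⧸ K) :=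
  Iff.rfl

theorem AddSubgroup.map_fst_ofQuotientHom (G : AddSubgroup A) (K : AddSubgroup B)
    (f : G →+ B ⧸ K) : (AddSubgroup.ofQuotientHom G K f).map (AddMonoidHom.fst A B) = G := by
  ext x
  simp only [AddSubgroup.mem_map, AddMonoidHom.coe_fst, AddSubgroup.mem_ofQuotientHom]
  constructor
  · rintro ⟨y, ⟨hy, -⟩, rfl⟩
    exact hy
  · intro hx
    obtain ⟨y, hy⟩ := QuotientAddGroup.mk_surjective (f ⟨x, hx⟩)
    exact ⟨(x, y), ⟨hx, hy.symm⟩, rfl⟩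

theorem AddSubgroup.comap_inr_ofQuotientHom (G : AddSubgroup A) (K : AddSubgroup B)
    (f : G →+ B ⧸ K) : (AddSubgroup.ofQuotientHom G K f).comap (AddMonoidHom.inr A B) = K := by
  ext y
  simp only [AddSubgroup.mem_comap, AddMonoidHom.inr_apply, AddSubgroup.mem_ofQuotientHom]
  have h0 : f ⟨0, G.zero_mem⟩ = 0 := f.map_zero
  constructor
  · rintro ⟨_, h⟩
    exact (QuotientAddGroup.eq_zero_iff y).1 (h.symm.trans h0)
  · intro hy
    exact ⟨G.zero_mem, h0.trans ((QuotientAddGroup.eq_zero_iff y).2 hy).symm⟩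

theorem AddSubgroup.ofQuotientHom_injective (G : AddSubgroup A) (K : AddSubgroup B) :
    Function.Injective (AddSubgroup.ofQuotientHom G K) := by
  intro f g hfg
  ext ⟨x, hx⟩
  obtain ⟨y, hy⟩ := QuotientAddGroup.mk_surjective (f ⟨x, hx⟩)
  have hmem : (x, y) ∈ AddSubgroup.ofQuotientHom G K f := ⟨hx, hy.symm⟩
  rw [hfg] at hmem
  obtain ⟨_, h⟩ := hmem
  exact hy.symm.trans h.symm

theorem AddSubgroup.exists_ofQuotientHom_eq (L : AddSubgroup (A × B)) :
    ∃ f, AddSubgroup.ofQuotientHom (L.map (AddMonoidHom.fst A B))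
      (L.comap (AddMonoidHom.inr A B)) f = L := by
  have hex (x : L.map (AddMonoidHom.fst A B)) : ∃ y : B, (x.1, y) ∈ L := by
    obtain ⟨_, ⟨x, y⟩, hxy, rfl⟩ := x
    exact ⟨y, hxy⟩
  choose s hs using hex
  have key {x : A} {y z : B} (hy : (x, y) ∈ L) (hz : (x, z) ∈ L) :
      (y : B ⧸ L.comap (AddMonoidHom.inr A B)) = z := by
    rw [QuotientAddGroup.eq, AddSubgroup.mem_comap]
    simpa using L.add_mem (L.neg_mem hy) hz
  refine ⟨AddMonoidHom.mk' (fun x => (s x : B ⧸ L.comap (AddMonoidHom.inr A B))) ?_, ?_⟩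
  · intro x y
    exact key (hs (x + y)) (L.add_mem (hs x) (hs y))
  · ext ⟨x, y⟩
    rw [AddSubgroup.mem_ofQuotientHom]
    constructor
    · rintro ⟨hx, h⟩
      have h' := QuotientAddGroup.eq.1 h
      rw [AddSubgroup.mem_comap] at h'
      simpa using L.add_mem (hs ⟨x, hx⟩) h'
    · intro h
      have hx : x ∈ L.map (AddMonoidHom.fst A B) := ⟨(x, y), h, rfl⟩
      exact ⟨hx, key (hs ⟨x, hx⟩) h⟩

theorem AddSubgroup.bijective_ofQuotientHom :
    Function.Bijective fun t : Σ (G : AddSubgroup A) (K : AddSubgroup B), G →+ B ⧸ K =>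
      AddSubgroup.ofQuotientHom t.1 t.2.1 t.2.2 := by
  constructor
  · rintro ⟨G, K, f⟩ ⟨G', K', f'⟩ h
    dsimp only at h
    obtain rfl : G = G' := by
      rw [← AddSubgroup.map_fst_ofQuotientHom G K f, h, AddSubgroup.map_fst_ofQuotientHom]
    obtain rfl : K = K' := by
      rw [← AddSubgroup.comap_inr_ofQuotientHom G K f, h, AddSubgroup.comap_inr_ofQuotientHom]
    rw [AddSubgroup.ofQuotientHom_injective G K h]
  · intro L
    obtain ⟨f, hf⟩ := AddSubgroup.exists_ofQuotientHom_eq L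
    exact ⟨⟨_, _, f⟩, hf⟩

end Goursat

section Cyclic

theorem IsAddCyclic.card_addMonoidHom (G H : Type*) [AddCommGroup G] [AddCommGroup H]
    [IsAddCyclic G] [IsAddCyclic H] [Finite H] :
    Nat.card (G →+ H) = (Nat.card H).gcd (Nat.card G) := by
  rw [← IsAddCyclic.card_nsmulAddMonoidHom_ker]
  refine Nat.card_congr (Equiv.trans ?_ (Equiv.trans (ZMod.lift (Nat.card G) (A := H)).symm ?_))
  · exact (zmodAddCyclicAddEquiv ‹IsAddCyclic G›).symm.addMonoidHomCongrLeftEquiv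
  · refine Equiv.subtypeEquiv (zmultiplesHom H).symm fun f => ?_
    rw [AddMonoidHom.mem_ker]
    simp [← map_nsmul]

theorem IsAddCyclic.ker_nsmul_card_eq {G : Type*} [AddCommGroup G] [IsAddCyclic G] [Finite G]
    (H : AddSubgroup G) : (nsmulAddMonoidHom (Nat.card H) : G →+ G).ker = H := by
  symm
  refine AddSubgroup.eq_of_le_of_card_ge (fun x hx => ?_) ?_
  · exact congrArg Subtype.val (card_nsmul_eq_zero' (x := (⟨x, hx⟩ : H)))
  · rw [IsAddCyclic.card_nsmulAddMonoidHom_ker]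
    exact Nat.gcd_le_right _ Nat.card_pos

theorem IsAddCyclic.sum_card_addSubgroup {G : Type*} [AddCommGroup G] [IsAddCyclic G] [Finite G]
    [Fintype (AddSubgroup G)] {M : Type*} [AddCommMonoid M] (f : ℕ → M) :
    ∑ H : AddSubgroup G, f (Nat.card H) = ∑ d ∈ (Nat.card G).divisors, f d := by
  refine Finset.sum_nbij' (fun H => Nat.card H) (fun d => (nsmulAddMonoidHom d : G →+ G).ker)
    ?_ ?_ ?_ ?_ ?_
  · intro H _
    exact Nat.mem_divisors.2 ⟨H.card_addSubgroup_dvd_card, Nat.card_pos.ne'⟩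
  · simp
  · intro H _
    exact IsAddCyclic.ker_nsmul_card_eq H
  · intro d hd
    rw [IsAddCyclic.card_nsmulAddMonoidHom_ker]
    exact Nat.gcd_eq_right (Nat.dvd_of_mem_divisors hd)
  · simp

theorem IsAddCyclic.sum_index_addSubgroup {G : Type*} [AddCommGroup G] [IsAddCyclic G] [Finite G]
    [Fintype (AddSubgroup G)] {M : Type*} [AddCommMonoid M] (f : ℕ → M) :
    ∑ H : AddSubgroup G, f H.index = ∑ d ∈ (Nat.card G).divisors, f d := by
  rw [← Nat.sum_div_divisors, ← IsAddCyclic.sum_card_addSubgroup]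
  refine Finset.sum_congr rfl fun H _ => ?_
  rw [← H.card_mul_index, Nat.mul_div_cancel_left _ Nat.card_pos]

theorem IsAddCyclic.card_addSubgroup_prod (A B : Type*) [AddCommGroup A] [AddCommGroup B]
    [IsAddCyclic A] [IsAddCyclic B] [Finite A] [Finite B] :
    Nat.card (AddSubgroup (A × B)) =
      ∑ d ∈ (Nat.card A).divisors, ∑ e ∈ (Nat.card B).divisors, e.gcd d := by
  have := Fintype.ofFinite (AddSubgroup A)
  have := Fintype.ofFinite (AddSubgroup B)
  have (G : AddSubgroup A) (K : AddSubgroup B) : Finite (G →+ B ⧸ K) := DFunLike.finite _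
  have (K : AddSubgroup B) : IsAddCyclic (B ⧸ K) :=
    isAddCyclic_of_surjective (QuotientAddGroup.mk' K) (QuotientAddGroup.mk'_surjective K)
  rw [← Nat.card_congr (Equiv.ofBijective _ AddSubgroup.bijective_ofQuotientHom), Nat.card_sigma,
    ← IsAddCyclic.sum_card_addSubgroup]
  refine Finset.sum_congr rfl fun G _ => ?_
  rw [Nat.card_sigma, ← IsAddCyclic.sum_index_addSubgroup]
  exact Finset.sum_congr rfl fun K _ => IsAddCyclic.card_addMonoidHom _ _

end Cyclic

theorem card_addSubgroup_zmod_prime_pow_prod {p : ℕ} (hp : p.Prime) (a b : ℕ) :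
    Nat.card (AddSubgroup (ZMod (p ^ a) × ZMod (p ^ b))) =
      ∑ i ∈ Finset.range (a + 1), ∑ j ∈ Finset.range (b + 1), p ^ min i j := by
  have : NeZero p := ⟨hp.ne_zero⟩
  rw [IsAddCyclic.card_addSubgroup_prod, Nat.card_zmod, Nat.card_zmod,
    Nat.sum_divisors_prime_pow hp]
  refine Finset.sum_congr rfl fun i _ => ?_
  rw [Nat.sum_divisors_prime_pow hp]
  refine Finset.sum_congr rfl fun j _ => ?_
  rcases le_total i j with h | h
  · rw [min_eq_left h, Nat.gcd_eq_right (pow_dvd_pow p h)]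
  · rw [min_eq_right h, Nat.gcd_eq_left (pow_dvd_pow p h)]

theorem sum_pow_min_mul_sub_one_sq {R : Type*} [CommRing R] (x : R) {a b : ℕ} (hab : a ≤ b) :
    (∑ i ∈ Finset.range (a + 1), ∑ j ∈ Finset.range (b + 1), x ^ min i j) * (x - 1) ^ 2 =
      ((b : R) - a + 1) * x ^ (a + 2) - ((b : R) - a - 1) * x ^ (a + 1)
        - ((a : R) + b + 3) * x + ((a : R) + b + 1) := by
  induction b, hab using Nat.le_induction with
  | base =>
    induction a with
    | zero => simp; ring
    | succ a ih =>
      have hcol : ∑ i ∈ Finset.range (a + 1), x ^ min i (a + 1) =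
          ∑ i ∈ Finset.range (a + 1), x ^ i :=
        Finset.sum_congr rfl fun i hi => by
          rw [min_eq_left (Finset.mem_range.1 hi).le]
      have hrow : ∑ j ∈ Finset.range (a + 1 + 1), x ^ min (a + 1) j =
          ∑ j ∈ Finset.range (a + 1 + 1), x ^ j :=
        Finset.sum_congr rfl fun j hj => by
          rw [min_eq_right (Nat.lt_succ_iff.1 (Finset.mem_range.1 hj))]
      rw [Finset.sum_range_succ, hrow]
      simp_rw [Finset.sum_range_succ _ (a + 1)]
      rw [Finset.sum_add_distrib, hcol]
      have hgeom := geom_sum_mul x (a + 1)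
      push_cast
      linear_combination ih + 2 * (x - 1) * hgeom
  | succ b hab ih =>
    have hcol : ∑ i ∈ Finset.range (a + 1), x ^ min i (b + 1) =
        ∑ i ∈ Finset.range (a + 1), x ^ i :=
      Finset.sum_congr rfl fun i hi => by
        rw [min_eq_left (by have := Finset.mem_range.1 hi; omega)]
    simp_rw [Finset.sum_range_succ _ (b + 1)]
    rw [Finset.sum_add_distrib, hcol]
    have hgeom := geom_sum_mul x (a + 1)
    push_cast
    linear_combination ih + (x - 1) * hgeom

theorem count_subgroups_p_group (p a b : ℕ) (hp : p.Prime) (hab : a ≤ b) :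
    (Nat.card (AddSubgroup (ZMod (p ^ a) × ZMod (p ^ b))) : ℚ) =
      (((b : ℚ) - a + 1) * (p : ℚ) ^ (a + 2) - ((b : ℚ) - a - 1) * (p : ℚ) ^ (a + 1)
        - ((a : ℚ) + b + 3) * p + ((a : ℚ) + b + 1)) / ((p : ℚ) - 1) ^ 2 := by
  have hp1 : (p : ℚ) - 1 ≠ 0 := sub_ne_zero.2 (by exact_mod_cast hp.one_lt.ne')
  rw [eq_div_iff (pow_ne_zero 2 hp1), ← sum_pow_min_mul_sub_one_sq _ hab,
    card_addSubgroup_zmod_prime_pow_prod hp]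
  push_cast
  rfl
end

section
/- Let p be a prime and let a, b, c be integers with 0 ≤ a ≤ b and 0 ≤ c ≤ a + b. The number of subgroups of order p^c of ℤ_{p^a} × ℤ_{p^b} equals (p^{c+1} − 1)/(p − 1) if c ≤ a ≤ b; equals (p^{a+1} − 1)/(p − 1) if a ≤ c ≤ b; and equals (p^{a+b−c+1} − 1)/(p − 1) if a ≤ b ≤ c ≤ a + b. -/
section Goursat

variable {A B : Type*} [AddCommGroup A] [AddCommGroup B]

/-- The preimage in `A × B` of the subgroup of `A × (B ⧸ Q)` generated by `(g, q)`. -/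
def zmultiplesPairComap (g : A) (Q : AddSubgroup B) (q : B ⧸ Q) : AddSubgroup (A × B) :=
  (AddSubgroup.zmultiples (g, q)).comap
    ((AddMonoidHom.id A).prodMap (QuotientAddGroup.mk' Q))

lemma mem_zmultiplesPairComap {g : A} {Q : AddSubgroup B} {q : B ⧸ Q} {x : A × B} :
    x ∈ zmultiplesPairComap g Q q ↔ ∃ n : ℤ, n • g = x.1 ∧ n • q = (x.2 : B ⧸ Q) := by
  simp [zmultiplesPairComap, AddSubgroup.mem_zmultiples_iff, Prod.ext_iff]

lemma map_fst_zmultiplesPairComap (g : A) (Q : AddSubgroup B) (q : B ⧸ Q) :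
    (zmultiplesPairComap g Q q).map (AddMonoidHom.fst A B) = AddSubgroup.zmultiples g := by
  ext x
  simp only [AddSubgroup.mem_map, mem_zmultiplesPairComap, AddSubgroup.mem_zmultiples_iff]
  constructor
  · rintro ⟨y, ⟨n, h, -⟩, rfl⟩
    exact ⟨n, h⟩
  · rintro ⟨n, rfl⟩
    obtain ⟨y, hy⟩ := QuotientAddGroup.mk_surjective (n • q)
    exact ⟨(n • g, y), ⟨n, rfl, hy.symm⟩, rfl⟩

lemma comap_inr_zmultiplesPairComap {g : A} {Q : AddSubgroup B} {q : B ⧸ Q}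
    (hq : addOrderOf g • q = 0) :
    (zmultiplesPairComap g Q q).comap (AddMonoidHom.inr A B) = Q := by
  ext y
  simp only [AddSubgroup.mem_comap, mem_zmultiplesPairComap, AddMonoidHom.inr_apply]
  constructor
  · rintro ⟨n, h, h'⟩
    obtain ⟨k, rfl⟩ := addOrderOf_dvd_iff_zsmul_eq_zero.mpr h
    rw [mul_comm, mul_zsmul, natCast_zsmul, hq, zsmul_zero] at h'
    exact (QuotientAddGroup.eq_zero_iff y).mp h'.symm
  · intro hy
    exact ⟨0, by simp, by simpa using ((QuotientAddGroup.eq_zero_iff y).mpr hy).symm⟩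

lemma zmultiplesPairComap_injOn (g : A) (Q : AddSubgroup B) :
    Set.InjOn (zmultiplesPairComap g Q) {q | addOrderOf g • q = 0} := by
  intro q _ q' hq' h
  obtain ⟨y, rfl⟩ := QuotientAddGroup.mk_surjective q
  have hy : (g, y) ∈ zmultiplesPairComap g Q q' :=
    h ▸ mem_zmultiplesPairComap.mpr ⟨1, by simp, by simp⟩
  obtain ⟨n, hn, hn'⟩ := mem_zmultiplesPairComap.mp hy
  obtain ⟨k, hk⟩ : (addOrderOf g : ℤ) ∣ n - 1 :=
    addOrderOf_dvd_iff_zsmul_eq_zero.mpr (by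
      rw [sub_zsmul, hn, one_zsmul]; exact add_neg_cancel g)
  have hzero : (n - 1) • q' = 0 := by
    rw [hk, mul_comm, mul_zsmul, natCast_zsmul, hq', zsmul_zero]
  rw [sub_zsmul, one_zsmul, ← sub_eq_add_neg, sub_eq_zero] at hzero
  exact hn'.symm.trans hzero

lemma exists_zmultiplesPairComap_eq {g : A} {Q : AddSubgroup B} {H : AddSubgroup (A × B)}
    (hg : H.map (AddMonoidHom.fst A B) = AddSubgroup.zmultiples g)
    (hQ : H.comap (AddMonoidHom.inr A B) = Q) :
    ∃ q : B ⧸ Q, addOrderOf g • q = 0 ∧ zmultiplesPairComap g Q q = H := by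
  subst hQ
  obtain ⟨⟨_, y⟩, hy, rfl⟩ : g ∈ H.map (AddMonoidHom.fst A B) :=
    hg ▸ AddSubgroup.mem_zmultiples g
  simp only [AddMonoidHom.coe_fst] at hg ⊢
  rename_i g
  refine ⟨(y : B ⧸ _), ?_, ?_⟩
  · rw [← QuotientAddGroup.mk_nsmul, QuotientAddGroup.eq_zero_iff]
    simpa [addOrderOf_nsmul_eq_zero] using H.nsmul_mem hy (addOrderOf g)
  · have key (n : ℤ) (z : B) :
        n • (y : B ⧸ H.comap (AddMonoidHom.inr A B)) = (z : B ⧸ _) ↔ (n • g, z) ∈ H := by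
      rw [← QuotientAddGroup.mk_zsmul, QuotientAddGroup.eq, AddSubgroup.mem_comap,
        ← H.add_mem_cancel_left (H.zsmul_mem hy n)]
      simp
    ext ⟨x, z⟩
    simp only [mem_zmultiplesPairComap, key]
    constructor
    · rintro ⟨n, rfl, h⟩
      exact h
    · intro h
      obtain ⟨n, rfl⟩ : x ∈ AddSubgroup.zmultiples g := hg ▸ ⟨_, h, rfl⟩
      exact ⟨n, rfl, h⟩

lemma card_map_fst_mul_card_comap_inr (H : AddSubgroup (A × B)) :
    Nat.card (H.map (AddMonoidHom.fst A B)) * Nat.card (H.comap (AddMonoidHom.inr A B)) =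
      Nat.card H := by
  let f := (AddMonoidHom.fst A B).comp H.subtype
  have hrange : f.range = H.map (AddMonoidHom.fst A B) := by
    rw [AddMonoidHom.range_comp, AddSubgroup.range_subtype]
  let e : H.comap (AddMonoidHom.inr A B) ≃ f.ker :=
    { toFun := fun y => ⟨⟨(0, y), y.2⟩, rfl⟩
      invFun := fun x => ⟨x.1.1.2, by
        have h : x.1.1 = (0, x.1.1.2) := Prod.ext x.2 rfl
        exact h ▸ x.1.2⟩
      left_inv := fun _ => rfl
      right_inv := fun x => Subtype.ext (Subtype.ext (Prod.ext (Eq.symm x.2) rfl)) }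
  rw [Nat.card_congr e, ← hrange, ← AddSubgroup.index_ker, mul_comm, AddSubgroup.card_mul_index]

end Goursat

section Cyclic

variable {A B : Type*} [AddCommGroup A] [AddCommGroup B]

lemma IsAddCyclic.card_eq_iff_eq_ker_nsmul [Finite A] [IsAddCyclic A] {n : ℕ} (hn : n ∣ Nat.card A) (S : AddSubgroup A) :
    Nat.card S = n ↔ S = (nsmulAddMonoidHom n : A →+ A).ker := by
  have hcard : Nat.card (nsmulAddMonoidHom n : A →+ A).ker = n := by
    rw [IsAddCyclic.card_nsmulAddMonoidHom_ker, Nat.gcd_eq_right hn]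
  refine ⟨fun hS => ?_, fun h => h ▸ hcard⟩
  refine AddSubgroup.eq_of_le_of_card_ge (fun x hx => ?_) (hcard.trans hS.symm).le
  have : Nat.card S • (⟨x, hx⟩ : S) = 0 := card_nsmul_eq_zero'
  rw [hS] at this
  simpa using congrArg Subtype.val this

/-- The number of subgroups of a product of two finite cyclic groups with prescribed orders of the
projection to the first factor and of the intersection with the second. -/
lemma card_addSubgroup_prod_of_card_map_fst_of_card_comap_inr
    [Finite A] [Finite B] [IsAddCyclic A] [IsAddCyclic B] {m n : ℕ}
    (hm : m ∣ Nat.card A) (hn : n ∣ Nat.card B) :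
    Nat.card {H : AddSubgroup (A × B) // Nat.card (H.map (AddMonoidHom.fst A B)) = m ∧
      Nat.card (H.comap (AddMonoidHom.inr A B)) = n} = (Nat.card B / n).gcd m := by
  obtain ⟨g, hg⟩ := (AddSubgroup.isAddCyclic_iff_exists_zmultiples_eq_top
    (nsmulAddMonoidHom m : A →+ A).ker).mp inferInstance
  set Q := (nsmulAddMonoidHom n : B →+ B).ker with hQ
  have hgm : addOrderOf g = m := by
    rw [← Nat.card_zmultiples]
    exact (IsAddCyclic.card_eq_iff_eq_ker_nsmul hm _).mpr hg
  have hQn : Nat.card Q = n := (IsAddCyclic.card_eq_iff_eq_ker_nsmul hn Q).mpr hQ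
  have himage : {H : AddSubgroup (A × B) | Nat.card (H.map (AddMonoidHom.fst A B)) = m ∧
      Nat.card (H.comap (AddMonoidHom.inr A B)) = n} =
      zmultiplesPairComap g Q '' {q | addOrderOf g • q = 0} := by
    ext H
    simp only [Set.mem_ofPred_eq, Set.mem_image, IsAddCyclic.card_eq_iff_eq_ker_nsmul hm,
      IsAddCyclic.card_eq_iff_eq_ker_nsmul hn, ← hg, ← hQ]
    constructor
    · rintro ⟨h, h'⟩
      exact exists_zmultiplesPairComap_eq h h'
    · rintro ⟨q, hq, rfl⟩
      exact ⟨map_fst_zmultiplesPairComap g Q q, comap_inr_zmultiplesPairComap hq⟩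
  have : IsAddCyclic (B ⧸ Q) :=
    isAddCyclic_of_surjective (QuotientAddGroup.mk' Q) (QuotientAddGroup.mk'_surjective Q)
  have hquot : Nat.card (B ⧸ Q) = Nat.card B / n := by
    rw [Q.card_eq_card_quotient_mul_card_addSubgroup, hQn,
      Nat.mul_div_cancel _ (hQn ▸ Nat.card_pos)]
  calc
    _ = Nat.card {q : B ⧸ Q | addOrderOf g • q = 0} := by
      rw [← Nat.card_image_of_injOn (zmultiplesPairComap_injOn g Q), ← himage]
      rfl
    _ = Nat.card (nsmulAddMonoidHom m : B ⧸ Q →+ B ⧸ Q).ker := by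
      rw [hgm]
      rfl
    _ = _ := by rw [IsAddCyclic.card_nsmulAddMonoidHom_ker, hquot]

/-- For `c ≤ a + b`, the order of the projection to the first factor of a subgroup of order `p ^ c`
is `p ^ (k + (c - b))` with `k ≤ min a c - (c - b)`, and each such `k` occurs for `p ^ k`
subgroups. -/
lemma card_addSubgroup_prod_card_eq_prime_pow [Finite A] [Finite B] [IsAddCyclic A]
    [IsAddCyclic B] {p a b c : ℕ} (hp : p.Prime) (hA : Nat.card A = p ^ a)
    (hB : Nat.card B = p ^ b) (hc : c ≤ a + b) :
    Nat.card {H : AddSubgroup (A × B) // Nat.card H = p ^ c} =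
      ∑ k ∈ Finset.range (min a c - (c - b) + 1), p ^ k := by
  let F (k : ℕ) := {H : AddSubgroup (A × B) //
    Nat.card (H.map (AddMonoidHom.fst A B)) = p ^ (k + (c - b)) ∧
      Nat.card (H.comap (AddMonoidHom.inr A B)) = p ^ (c - (k + (c - b)))}
  have hF (k : Fin (min a c - (c - b) + 1)) : Nat.card (F k) = p ^ (k : ℕ) := by
    have hk := k.2
    rw [card_addSubgroup_prod_of_card_map_fst_of_card_comap_inr
      (hA ▸ Nat.pow_dvd_pow p (by omega)) (hB ▸ Nat.pow_dvd_pow p (by omega)), hB,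
      Nat.pow_div (by omega) hp.pos]
    rcases le_total c b with hcb | hcb
    · rw [Nat.gcd_eq_right (Nat.pow_dvd_pow p (by omega))]
      congr 1
      omega
    · rw [Nat.gcd_eq_left (Nat.pow_dvd_pow p (by omega))]
      congr 1
      omega
  let f (x : Σ k : Fin (min a c - (c - b) + 1), F k) :
      {H : AddSubgroup (A × B) // Nat.card H = p ^ c} :=
    ⟨x.2.1, by
      have hk := x.1.2
      rw [← card_map_fst_mul_card_comap_inr, x.2.2.1, x.2.2.2, ← pow_add]
      congr 1
      omega⟩
  have hf : Function.Bijective f := by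
    constructor
    · rintro ⟨k, H, hH⟩ ⟨k', H', hH'⟩ h
      obtain rfl : H = H' := congrArg Subtype.val h
      have := Nat.pow_right_injective hp.two_le (hH.1.symm.trans hH'.1)
      obtain rfl : k = k' := Fin.ext (by omega)
      rfl
    · rintro ⟨H, hH⟩
      obtain ⟨i, hi, hi'⟩ := (Nat.dvd_prime_pow hp).mp
        (hA ▸ AddSubgroup.card_addSubgroup_dvd_card (H.map (AddMonoidHom.fst A B)))
      obtain ⟨j, hj, hj'⟩ := (Nat.dvd_prime_pow hp).mp
        (hB ▸ AddSubgroup.card_addSubgroup_dvd_card (H.comap (AddMonoidHom.inr A B)))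
      have hij : i + j = c := Nat.pow_right_injective hp.two_le (by
        simp only [pow_add]
        rw [← hi', ← hj', card_map_fst_mul_card_comap_inr, hH])
      refine ⟨⟨⟨i - (c - b), by omega⟩, H, ?_, ?_⟩, rfl⟩
      · rw [hi']
        congr 1
        simp only
        omega
      · rw [hj']
        congr 1
        simp only
        omega
  rw [← Nat.card_eq_of_bijective f hf, Nat.card_sigma, Finset.sum_congr rfl fun k _ => hF k,
    Fin.sum_univ_eq_sum_range (p ^ ·)]

end Cyclic

theorem count_subgroups_p_group_order (p a b c : ℕ) (hp : p.Prime) (hab : a ≤ b)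
    (hc : c ≤ a + b) :
    (c ≤ a →
      Nat.card {H : AddSubgroup (ZMod (p ^ a) × ZMod (p ^ b)) // Nat.card H = p ^ c} =
        (p ^ (c + 1) - 1) / (p - 1)) ∧
    (a ≤ c → c ≤ b →
      Nat.card {H : AddSubgroup (ZMod (p ^ a) × ZMod (p ^ b)) // Nat.card H = p ^ c} =
        (p ^ (a + 1) - 1) / (p - 1)) ∧
    (b ≤ c →
      Nat.card {H : AddSubgroup (ZMod (p ^ a) × ZMod (p ^ b)) // Nat.card H = p ^ c} =
        (p ^ (a + b - c + 1) - 1) / (p - 1)) := by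
  have : NeZero (p ^ a) := ⟨pow_ne_zero a hp.ne_zero⟩
  have : NeZero (p ^ b) := ⟨pow_ne_zero b hp.ne_zero⟩
  rw [card_addSubgroup_prod_card_eq_prime_pow hp (Nat.card_zmod _) (Nat.card_zmod _) hc,
    Nat.geomSum_eq hp.two_le]
  refine ⟨fun h => ?_, fun h h' => ?_, fun h => ?_⟩ <;> congr 4 <;> omega
end

section
/- For all positive integers n and δ with δ ∣ n, the number of subgroups of ℤ_n × ℤ_n whose exponent equals δ is equal to the number of cyclic subgroups of ℤ_δ × ℤ_δ. -/
namespace ZModPlane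

/-- The symplectic form on the free module of rank two. -/
def symp {R : Type*} [CommRing R] (x y : R × R) : R := x.1 * y.2 - x.2 * y.1

section Ring

variable {R : Type*} [CommRing R]

lemma symp_add_left (x y z : R × R) : symp (x + y) z = symp x z + symp y z := by
  simp only [symp, Prod.fst_add, Prod.snd_add]; ring

lemma symp_smul_left (c : R) (x z : R × R) : symp (c • x) z = c * symp x z := by
  simp only [symp, Prod.smul_fst, Prod.smul_snd, smul_eq_mul]; ring

lemma symp_smul_right (c : R) (x z : R × R) : symp x (c • z) = c * symp x z := by
  simp only [symp, Prod.smul_fst, Prod.smul_snd, smul_eq_mul]; ring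

lemma symp_swap (x y : R × R) : symp x y = -symp y x := by
  simp only [symp]; ring

lemma symp_self (x : R × R) : symp x x = 0 := by
  simp only [symp]; ring

lemma eq_symp_smul_add {w u : R × R} (h : symp w u = 1) (x : R × R) :
    x = symp x u • w + symp w x • u := by
  simp only [symp] at *
  ext <;> simp only [Prod.fst_add, Prod.snd_add, Prod.smul_fst, Prod.smul_snd, smul_eq_mul]
  · linear_combination (-x.1) * h
  · linear_combination (-x.2) * h

/-- The orthogonal complement of a subgroup with respect to the symplectic form. -/
def perp (H : AddSubgroup (R × R)) : AddSubgroup (R × R) where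
  carrier := {x | ∀ y ∈ H, symp x y = 0}
  zero_mem' := fun y _ => by simp [symp]
  add_mem' := fun {a b} ha hb y hy => by rw [symp_add_left, ha y hy, hb y hy, add_zero]
  neg_mem' := fun {a} ha y hy => by
    have := symp_smul_left (-1) a y
    rwa [ha y hy, mul_zero, neg_one_smul] at this

lemma mem_perp {H : AddSubgroup (R × R)} {x : R × R} :
    x ∈ perp H ↔ ∀ y ∈ H, symp x y = 0 := Iff.rfl

lemma le_perp_perp (H : AddSubgroup (R × R)) : H ≤ perp (perp H) := fun x hx y hy => by
  rw [symp_swap, hy x hx, neg_zero]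

end Ring

variable {d : ℕ}

lemma exists_smul_unimodular (v : ZMod d × ZMod d) :
    ∃ (g : ZMod d) (w u : ZMod d × ZMod d), v = g • w ∧ symp w u = 1 := by
  obtain ⟨⟨a, ha⟩, ⟨b, hb⟩⟩ := And.intro (ZMod.intCast_surjective v.1) (ZMod.intCast_surjective v.2)
  by_cases h : a = 0 ∧ b = 0
  · refine ⟨0, (1, 0), (0, 1), ?_, by simp [symp]⟩
    ext <;> simp [← ha, ← hb, h.1, h.2]
  · have hg : 0 < Int.gcd a b := Int.gcd_pos_iff.mpr (by tauto)
    obtain ⟨a', b', hc, h1, h2⟩ := Int.exists_gcd_one hg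
    obtain ⟨s, t, hst⟩ := Int.isCoprime_iff_gcd_eq_one.mpr hc
    refine ⟨(Int.gcd a b : ℤ), (a', b'), ((-t : ℤ), (s : ℤ)), ?_, ?_⟩
    · ext
      · simp only [Prod.smul_fst, smul_eq_mul]
        rw [← ha, ← Int.cast_mul, mul_comm, ← h1]
      · simp only [Prod.smul_snd, smul_eq_mul]
        rw [← hb, ← Int.cast_mul, mul_comm, ← h2]
    · simp only [symp]
      rw [← Int.cast_mul, ← Int.cast_mul, ← Int.cast_sub, ← Int.cast_one]
      congr 1
      linear_combination hst

lemma dvd_of_annihilator_le [NeZero d] {g s : ZMod d} (h : ∀ t, t * g = 0 → t * s = 0) :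
    g ∣ s := by
  obtain ⟨k, hk⟩ := Nat.gcd_dvd_right g.val d
  have hd : 0 < d := NeZero.pos d
  have hk0 : 0 < k := Nat.pos_of_ne_zero fun h0 => by simp [h0] at hk; omega
  have hgcd : ((g.val.gcd d : ℕ) : ZMod d) = g * (g.val.gcdA d : ZMod d) := by
    have := congrArg (Int.cast : ℤ → ZMod d) (Nat.gcd_eq_gcd_ab g.val d)
    simpa using this
  have hs : (k : ZMod d) * s = 0 := by
    apply h
    obtain ⟨m, hm⟩ := Nat.gcd_dvd_left g.val d
    rw [← ZMod.natCast_zmod_val g, ← Nat.cast_mul, ZMod.natCast_eq_zero_iff]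
    exact ⟨m, by nth_rewrite 2 [hk]; nth_rewrite 1 [hm]; ring⟩
  rw [← ZMod.natCast_zmod_val s, ← Nat.cast_mul, ZMod.natCast_eq_zero_iff] at hs
  nth_rewrite 1 [hk] at hs
  rw [mul_comm] at hs
  obtain ⟨r, hr⟩ := Nat.dvd_of_mul_dvd_mul_left hk0 hs
  refine ⟨(g.val.gcdA d : ZMod d) * r, ?_⟩
  rw [← mul_assoc, ← hgcd, ← Nat.cast_mul, ← hr, ZMod.natCast_zmod_val]

lemma addOrderOf_of_symp_eq_one {w u : ZMod d × ZMod d} (h : symp w u = 1) :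
    addOrderOf w = d := by
  apply Nat.dvd_antisymm
  · rw [addOrderOf_dvd_iff_nsmul_eq_zero, ← Nat.cast_smul_eq_nsmul (ZMod d)]
    simp
  · have h0 := addOrderOf_nsmul_eq_zero w
    rw [← Nat.cast_smul_eq_nsmul (ZMod d)] at h0
    rw [← ZMod.natCast_eq_zero_iff]
    have := symp_smul_left (addOrderOf w : ZMod d) w u
    rw [h0, h, mul_one] at this
    rw [← this]; simp [symp]

lemma exponent_eq_of_mem {H : AddSubgroup (ZMod d × ZMod d)} {w u : ZMod d × ZMod d}
    (hw : w ∈ H) (h : symp w u = 1) : AddMonoid.exponent H = d := by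
  apply Nat.dvd_antisymm
  · apply AddMonoid.exponent_dvd_of_forall_nsmul_eq_zero
    intro g
    ext <;> simp
  · have := AddMonoid.addOrder_dvd_exponent (⟨w, hw⟩ : H)
    rwa [AddSubgroup.addOrderOf_mk, addOrderOf_of_symp_eq_one h] at this

lemma exists_unimodular_mem [NeZero d] {H : AddSubgroup (ZMod d × ZMod d)}
    (h : AddMonoid.exponent H = d) : ∃ w ∈ H, ∃ u, symp w u = 1 := by
  obtain ⟨⟨v, hv⟩, ho⟩ := AddMonoid.exists_addOrderOf_eq_exponent
    (AddMonoid.ExponentExists.of_finite (G := H))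
  rw [AddSubgroup.addOrderOf_mk, h] at ho
  obtain ⟨g, w, u, rfl, hwu⟩ := exists_smul_unimodular v
  have hg : g ∣ 1 := by
    apply dvd_of_annihilator_le
    intro t ht
    have h0 : t.val • (g • w) = 0 := by
      rw [← Nat.cast_smul_eq_nsmul (ZMod d), ZMod.natCast_zmod_val, smul_smul, ht, zero_smul]
    rw [← addOrderOf_dvd_iff_nsmul_eq_zero, ho, ← ZMod.natCast_eq_zero_iff,
      ZMod.natCast_zmod_val] at h0
    rw [h0, zero_mul]
  obtain ⟨r, hr⟩ := hg
  refine ⟨w, ?_, u, hwu⟩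
  have := ZMod.smul_mem hv r
  rwa [smul_smul, mul_comm, ← hr, one_smul] at this

lemma isAddCyclic_perp [NeZero d] {H : AddSubgroup (ZMod d × ZMod d)}
    (h : AddMonoid.exponent H = d) : IsAddCyclic (perp H) := by
  obtain ⟨w, hw, u, hwu⟩ := exists_unimodular_mem h
  have hle : perp H ≤ AddSubgroup.zmultiples w := fun x hx => by
    rw [eq_symp_smul_add hwu x, symp_swap w x, hx w hw, neg_zero, zero_smul, add_zero]
    exact ZMod.smul_mem (AddSubgroup.mem_zmultiples w) _
  exact isAddCyclic_of_injective (AddSubgroup.inclusion hle) (AddSubgroup.inclusion_injective hle)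

lemma perp_perp_of_exponent [NeZero d] {H : AddSubgroup (ZMod d × ZMod d)}
    (h : AddMonoid.exponent H = d) : perp (perp H) = H := by
  obtain ⟨w, hw, u, hwu⟩ := exists_unimodular_mem h
  refine le_antisymm (fun x hx => ?_) (le_perp_perp H)
  let K : AddSubgroup (ZMod d) := H.comap (LinearMap.toSpanSingleton (ZMod d) _ u).toAddMonoidHom
  have hK : ∀ t, t ∈ K ↔ t • u ∈ H := fun t => Iff.rfl
  obtain ⟨⟨m, hm⟩, hgen⟩ := IsAddCyclic.exists_generator (α := K)
  have hmem : symp w x • u ∈ H := by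
    obtain ⟨r, hr⟩ : m ∣ symp w x := by
      apply dvd_of_annihilator_le
      intro t ht
      have htw : t • w ∈ perp H := fun y hy => by
        have hy2 : symp w y ∈ K := by
          rw [hK]
          have := H.sub_mem hy (ZMod.smul_mem hw (symp y u))
          nth_rewrite 1 [eq_symp_smul_add hwu y] at this
          rwa [add_sub_cancel_left] at this
        obtain ⟨k, hk⟩ := AddSubgroup.mem_zmultiples_iff.mp (hgen ⟨_, hy2⟩)
        have hk' : k • m = symp w y := congrArg Subtype.val hk
        rw [symp_smul_left, ← hk', mul_smul_comm, ht, smul_zero]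
      have := hx _ htw
      rw [symp_swap, symp_smul_left] at this
      simpa using this
    rw [hr, mul_comm, ← smul_smul]
    exact ZMod.smul_mem ((hK m).mp hm) r
  rw [eq_symp_smul_add hwu x]
  exact H.add_mem (ZMod.smul_mem hw _) hmem

lemma exists_zmultiples_of_isAddCyclic {C : AddSubgroup (ZMod d × ZMod d)} (hC : IsAddCyclic C) :
    ∃ (g : ZMod d) (w u : ZMod d × ZMod d),
      C = AddSubgroup.zmultiples (g • w) ∧ symp w u = 1 := by
  obtain ⟨v, hv⟩ := AddSubgroup.isAddCyclic_iff_exists_zmultiples_eq_top C |>.mp hC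
  obtain ⟨g, w, u, rfl, h⟩ := exists_smul_unimodular v
  exact ⟨g, w, u, hv.symm, h⟩

lemma mem_perp_zmultiples {v x : ZMod d × ZMod d} :
    x ∈ perp (AddSubgroup.zmultiples v) ↔ symp x v = 0 := by
  refine ⟨fun h => h v (AddSubgroup.mem_zmultiples v), fun h y hy => ?_⟩
  obtain ⟨k, rfl⟩ := AddSubgroup.mem_zmultiples_iff.mp hy
  rw [← Int.cast_smul_eq_zsmul (ZMod d), symp_smul_right, h, mul_zero]

lemma exponent_perp {C : AddSubgroup (ZMod d × ZMod d)} (hC : IsAddCyclic C) :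
    AddMonoid.exponent (perp C) = d := by
  obtain ⟨g, w, u, rfl, hwu⟩ := exists_zmultiples_of_isAddCyclic hC
  refine exponent_eq_of_mem (w := w) (mem_perp_zmultiples.mpr ?_) hwu
  rw [symp_smul_right, symp_self, mul_zero]

lemma perp_perp_of_isAddCyclic [NeZero d] {C : AddSubgroup (ZMod d × ZMod d)}
    (hC : IsAddCyclic C) : perp (perp C) = C := by
  refine le_antisymm (fun x hx => ?_) (le_perp_perp C)
  obtain ⟨g, w, u, rfl, hwu⟩ := exists_zmultiples_of_isAddCyclic hC
  have hxw : symp x w = 0 := hx w <| mem_perp_zmultiples.mpr <| by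
    rw [symp_smul_right, symp_self, mul_zero]
  obtain ⟨r, hr⟩ : g ∣ symp x u := by
    apply dvd_of_annihilator_le
    intro t ht
    rw [← symp_smul_right]
    refine hx _ (mem_perp_zmultiples.mpr ?_)
    rw [symp_smul_left, symp_smul_right, ← mul_assoc, ht, zero_mul]
  rw [eq_symp_smul_add hwu x, symp_swap w x, hxw, neg_zero, zero_smul, add_zero, hr, mul_comm,
    ← smul_smul]
  exact ZMod.smul_mem (AddSubgroup.mem_zmultiples _) r

/-- Taking orthogonal complements exchanges the subgroups of full exponent and the cyclic ones. -/
def perpEquiv (d : ℕ) [NeZero d] :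
    {H : AddSubgroup (ZMod d × ZMod d) // AddMonoid.exponent H = d} ≃
      {H : AddSubgroup (ZMod d × ZMod d) // IsAddCyclic H} where
  toFun H := ⟨perp H.1, isAddCyclic_perp H.2⟩
  invFun C := ⟨perp C.1, exponent_perp C.2⟩
  left_inv H := Subtype.ext (perp_perp_of_exponent H.2)
  right_inv C := Subtype.ext (perp_perp_of_isAddCyclic C.2)

/-- The embedding of `ZMod d` into `ZMod (d * k)` given by multiplication by `k`. -/
def mulHom (d k : ℕ) : ZMod d →+ ZMod (d * k) :=
  ZMod.lift d ⟨zmultiplesHom _ (k : ZMod (d * k)), by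
    simpa [-CharP.cast_eq_zero] using (Nat.cast_mul d k).symm.trans (ZMod.natCast_self (d * k))⟩

lemma mulHom_intCast (d k : ℕ) (a : ℤ) : mulHom d k a = ((a * k : ℤ) : ZMod (d * k)) := by
  simp [mulHom]

lemma mulHom_injective {k : ℕ} (hk : 0 < k) : Function.Injective (mulHom d k) := by
  rw [injective_iff_map_eq_zero]
  intro x hx
  obtain ⟨a, rfl⟩ := ZMod.intCast_surjective x
  rw [mulHom_intCast, ZMod.intCast_zmod_eq_zero_iff_dvd, Nat.cast_mul] at hx
  rw [ZMod.intCast_zmod_eq_zero_iff_dvd]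
  exact Int.dvd_of_mul_dvd_mul_right (by exact_mod_cast hk.ne') hx

lemma mem_range_mulHom {k : ℕ} (hd : 0 < d) {y : ZMod (d * k)} (hy : d • y = 0) :
    ∃ x, mulHom d k x = y := by
  obtain ⟨a, rfl⟩ := ZMod.intCast_surjective y
  have h : ((d * a : ℤ) : ZMod (d * k)) = 0 := by simpa using hy
  rw [ZMod.intCast_zmod_eq_zero_iff_dvd, Nat.cast_mul] at h
  obtain ⟨b, rfl⟩ := Int.dvd_of_mul_dvd_mul_left (by exact_mod_cast hd.ne') h
  exact ⟨b, by rw [mulHom_intCast, mul_comm b]⟩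

lemma card_exponent_mul {k : ℕ} (hd : 0 < d) (hk : 0 < k) :
    Nat.card {H : AddSubgroup (ZMod d × ZMod d) // AddMonoid.exponent H = d} =
      Nat.card {H : AddSubgroup (ZMod (d * k) × ZMod (d * k)) // AddMonoid.exponent H = d} := by
  let f := (mulHom d k).prodMap (mulHom d k)
  have hf : Function.Injective f := (mulHom_injective hk).prodMap (mulHom_injective hk)
  have hexp (H : AddSubgroup (ZMod d × ZMod d)) :
      AddMonoid.exponent (H.map f) = AddMonoid.exponent H :=
    (AddMonoid.exponent_eq_of_addEquiv (H.equivMapOfInjective f hf)).symm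
  refine Nat.card_congr (Equiv.ofBijective (fun H => ⟨H.1.map f, (hexp H.1).trans H.2⟩) ⟨?_, ?_⟩)
  · intro H K h
    exact Subtype.ext (AddSubgroup.map_injective hf (congrArg Subtype.val h))
  · rintro ⟨H, hH⟩
    have hle : H ≤ f.range := fun y hy => by
      have h0 : d • y = 0 := by
        have := AddMonoid.exponent_nsmul_eq_zero (⟨y, hy⟩ : H)
        rw [hH] at this
        exact congrArg Subtype.val this
      obtain ⟨a, ha⟩ := mem_range_mulHom hd (congrArg Prod.fst h0)
      obtain ⟨b, hb⟩ := mem_range_mulHom hd (congrArg Prod.snd h0)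
      exact ⟨(a, b), Prod.ext ha hb⟩
    have hmap : (H.comap f).map f = H := AddSubgroup.map_comap_eq_self hle
    refine ⟨⟨H.comap f, ?_⟩, Subtype.ext hmap⟩
    rw [← hexp, hmap, hH]

end ZModPlane

theorem count_subgroups_of_exponent (n δ : ℕ) (hn : 0 < n) (hδ : 0 < δ) (hδn : δ ∣ n) :
    Nat.card {H : AddSubgroup (ZMod n × ZMod n) // AddMonoid.exponent H = δ} =
      Nat.card {H : AddSubgroup (ZMod δ × ZMod δ) // IsAddCyclic H} := by
  obtain ⟨k, rfl⟩ := hδn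
  have : NeZero δ := ⟨hδ.ne'⟩
  rw [← ZModPlane.card_exponent_mul hδ (Nat.pos_of_mul_pos_left hn)]
  exact Nat.card_congr (ZModPlane.perpEquiv δ)
end
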